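/- Let m ≥ 3 be an odd integer and q = 2^m. Partition the Delsarte–Goethals code 𝒟𝒢 into ten classes: S_0 = {z : w_L(z) = 0}, S_1 = {z : w_L(z) = q − 2^{(m+1)/2}}, S′_{21} = {z : w_L(z) = q − 2^{(m−1)/2} and z ∈ 𝒦}, S′_{22} = {z : w_L(z) = q − 2^{(m−1)/2} and z ∉ 𝒦}, S_3 = {z : w_L(z) = q and z ∈ 𝒦}, S_4 = {z : w_L(z) = q and z ∉ 𝒦}, S′_{51} = {z : w_L(z) = q + 2^{(m−1)/2} and z ∉ 𝒦}, S′_{52} = {z : w_L(z) = q + 2^{(m−1)/2} and z ∈ 𝒦}, S_6 = {z : w_L(z) = q + 2^{(m+1)/2}}, S_7 = {z : w_L(z) = 2q}. Then these ten sets form a partition of 𝒟𝒢, each is closed under negation, and the induced translation relations form a 9-class association scheme: for any two classes C, C′ of the partition and any two codewords z, z′ lying in the same class, the number of pairs (r,s) ∈ C × C′ with r + s = z equals the number of pairs (r,s) ∈ C × C′ with r + s = z′. -/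

import Mathlib

open Polynomial

/-- The Teichmüller set `𝒯 = {z ∈ R : z ^ 2^m = z}` of the Galois ring
`R = GR(4,m) = (ℤ/4ℤ)[x]/(f)`, as a type. -/
abbrev Teich (m : ℕ) (f : Polynomial (ZMod 4)) : Type :=
  {z : AdjoinRoot f // z ^ 2 ^ m = z}

/-- The ambient space `(ℤ/4ℤ)^𝒯` of quaternary words indexed by the Teichmüller set. -/
abbrev Word (m : ℕ) (f : Polynomial (ZMod 4)) : Type := Teich m f → ZMod 4

/-- The codeword `c(u,a,b)` with entry `c(u,a,b)_X = u + T(aX + 2bX³)`, `T` being the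
algebra trace of `R` over `ℤ/4ℤ`. -/
noncomputable def cword (m : ℕ) (f : Polynomial (ZMod 4))
    (u : ZMod 4) (a b : AdjoinRoot f) : Word m f :=
  fun X => u + Algebra.trace (ZMod 4) (AdjoinRoot f) (a * X.1 + 2 * b * X.1 ^ 3)

/-- The Lee weight of a single `ℤ/4ℤ`-symbol: `wt 0 = 0`, `wt 1 = wt 3 = 1`, `wt 2 = 2`. -/
def symWt (x : ZMod 4) : ℕ := if x = 0 then 0 else if x = 2 then 2 else 1

/-- The Lee weight `w_L(v) = Σ_X wt(v_X)`. -/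
noncomputable def leeWt (m : ℕ) (f : Polynomial (ZMod 4)) (v : Word m f) : ℕ :=
  ∑ᶠ X : Teich m f, symWt (v X)

/-- The quaternary Kerdock code `𝒦 = {c(u,a,0) : u ∈ ℤ/4ℤ, a ∈ R}`. -/
def Kerdock (m : ℕ) (f : Polynomial (ZMod 4)) : Set (Word m f) :=
  {v | ∃ u a, v = cword m f u a 0}

/-- The quaternary Delsarte–Goethals code
`𝒟𝒢 = {c(u,a,b) : u ∈ ℤ/4ℤ, a ∈ R, b ∈ 𝒯}`. -/
def DG (m : ℕ) (f : Polynomial (ZMod 4)) : Set (Word m f) :=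
  {v | ∃ u a b, b ^ 2 ^ m = b ∧ v = cword m f u a b}

/-- The refined partition `S_0, S_1, S'_21, S'_22, S_3, S_4, S'_51, S'_52, S_6, S_7` of the
Delsarte–Goethals code: by Lee weights `0, q - √(2q), q - √(q/2), q - √(q/2), q, q,
q + √(q/2), q + √(q/2), q + √(2q), 2q` (where `q = 2^m`, `√(2q) = 2^((m+1)/2)`,
`√(q/2) = 2^((m-1)/2)`), the weight-`q ± √(q/2)` and weight-`q` classes being further
split by membership in the Kerdock code. -/
noncomputable def DGclass' (m : ℕ) (f : Polynomial (ZMod 4)) : Fin 10 → Set (Word m f) :=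
  ![{z | z ∈ DG m f ∧ leeWt m f z = 0},
    {z | z ∈ DG m f ∧ leeWt m f z = 2 ^ m - 2 ^ ((m + 1) / 2)},
    {z | z ∈ DG m f ∧ leeWt m f z = 2 ^ m - 2 ^ ((m - 1) / 2) ∧ z ∈ Kerdock m f},
    {z | z ∈ DG m f ∧ leeWt m f z = 2 ^ m - 2 ^ ((m - 1) / 2) ∧ z ∉ Kerdock m f},
    {z | z ∈ DG m f ∧ leeWt m f z = 2 ^ m ∧ z ∈ Kerdock m f},
    {z | z ∈ DG m f ∧ leeWt m f z = 2 ^ m ∧ z ∉ Kerdock m f},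
    {z | z ∈ DG m f ∧ leeWt m f z = 2 ^ m + 2 ^ ((m - 1) / 2) ∧ z ∉ Kerdock m f},
    {z | z ∈ DG m f ∧ leeWt m f z = 2 ^ m + 2 ^ ((m - 1) / 2) ∧ z ∈ Kerdock m f},
    {z | z ∈ DG m f ∧ leeWt m f z = 2 ^ m + 2 ^ ((m + 1) / 2)},
    {z | z ∈ DG m f ∧ leeWt m f z = 2 * 2 ^ m}]


namespace DelsarteGoethals

open scoped Classical

section Fourier

/-- A symmetric nondegenerate complex-valued bicharacter on a finite abelian group. -/
structure SelfPairing (G : Type*) [AddCommGroup G] [Fintype G] where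
  /-- The value of the pairing. -/
  e : G → G → ℂ
  add_right : ∀ z g h, e z (g + h) = e z g * e z h
  comm : ∀ z g, e z g = e g z
  sum_eq : ∀ z, ∑ g, e z g = if z = 0 then (Fintype.card G : ℂ) else 0

variable {G : Type*} [AddCommGroup G] [Fintype G] (P : SelfPairing G)

namespace SelfPairing

lemma add_left (z w g : G) : P.e (z + w) g = P.e z g * P.e w g := by
  rw [P.comm, P.add_right, P.comm g z, P.comm g w]

/-- The Fourier transform attached to a self-pairing. -/
noncomputable def ft (φ : G → ℂ) (g : G) : ℂ := ∑ z, φ z * P.e z g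

lemma ft_ft (φ : G → ℂ) (g : G) : P.ft (P.ft φ) g = Fintype.card G * φ (-g) := by
  have h1 : ∀ y z, φ z * P.e z y * P.e y g = φ z * P.e (z + g) y := by
    intro y z
    rw [P.add_left, P.comm y g, mul_assoc]
  simp only [ft, Finset.sum_mul, h1]
  rw [Finset.sum_comm]
  simp only [← Finset.mul_sum, P.sum_eq, mul_ite, mul_zero, add_eq_zero_iff_eq_neg]
  rw [Finset.sum_ite_eq' Finset.univ (-g)]
  simp [mul_comm]

lemma ft_injective : Function.Injective P.ft := by
  intro φ ψ h
  funext g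
  have h1 : P.ft (P.ft φ) (-g) = P.ft (P.ft ψ) (-g) := by rw [h]
  rw [ft_ft, ft_ft, neg_neg] at h1
  have : (Fintype.card G : ℂ) ≠ 0 := by exact_mod_cast Fintype.card_ne_zero
  exact mul_left_cancel₀ this h1

lemma ft_add (φ ψ : G → ℂ) : P.ft (φ + ψ) = P.ft φ + P.ft ψ := by
  funext g
  simp [ft, add_mul, Finset.sum_add_distrib]

lemma ft_smul (r : ℂ) (φ : G → ℂ) : P.ft (r • φ) = r • P.ft φ := by
  funext g
  simp [ft, mul_assoc, Finset.mul_sum]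

lemma ft_eq_zero_of_invariant (φ : G → ℂ) (g h : G) (hφ : ∀ z, φ (z + h) = φ z)
    (he : P.e h g ≠ 1) : P.ft φ g = 0 := by
  have h1 : P.ft φ g = P.ft φ g * P.e h g := by
    conv_lhs => rw [ft, ← Equiv.sum_comp (Equiv.addRight h)]
    simp only [Equiv.coe_addRight, hφ, P.add_left, ft, Finset.sum_mul, mul_assoc]
  have h2 : P.ft φ g * (P.e h g - 1) = 0 := by linear_combination -h1
  exact (mul_eq_zero.mp h2).resolve_right (sub_ne_zero.mpr he)

/-- Convolution of functions on a finite abelian group. -/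
noncomputable def conv (φ ψ : G → ℂ) (z : G) : ℂ := ∑ r, φ r * ψ (z - r)

lemma ft_conv (φ ψ : G → ℂ) (g : G) : P.ft (conv φ ψ) g = P.ft φ g * P.ft ψ g := by
  simp only [ft, conv, Finset.sum_mul]
  rw [Finset.sum_comm]
  refine Finset.sum_congr rfl fun r _ => ?_
  rw [Finset.mul_sum, ← Equiv.sum_comp (Equiv.addRight r)]
  refine Finset.sum_congr rfl fun s _ => ?_
  simp only [Equiv.coe_addRight, add_sub_cancel_right, P.add_left]
  ring

/-- The functions whose Fourier transform is constant on the fibres of `d`. -/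
def fibreConst {κ : Type*} (d : G → κ) : Submodule ℂ (G → ℂ) where
  carrier := {φ | ∀ g g', d g = d g' → P.ft φ g = P.ft φ g'}
  add_mem' := by
    intro φ ψ hφ hψ g g' h
    simp only [ft_add, Pi.add_apply, hφ g g' h, hψ g g' h]
  zero_mem' := by
    intro g g' _
    simp [ft]
  smul_mem' := by
    intro r φ hφ g g' h
    simp only [ft_smul, Pi.smul_apply, hφ g g' h]

/-- If a partition of `G` has as many classes as a partition of the dual group on whose blocks
the transforms of its class indicators are constant, then convolutions of class indicators are
constant on classes. -/
theorem conv_indicator_const {ι κ : Type*} [Fintype ι] [DecidableEq ι] [Fintype κ]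
    (hcard : Fintype.card ι = Fintype.card κ) (c : G → ι) (d : G → κ)
    (hc : Function.Surjective c)
    (hft : ∀ i, (fun z => if c z = i then (1 : ℂ) else 0) ∈ P.fibreConst d)
    (i j : ι) {z z' : G} (hz : c z = c z') :
    conv (fun r => if c r = i then (1 : ℂ) else 0) (fun r => if c r = j then (1 : ℂ) else 0) z =
    conv (fun r => if c r = i then (1 : ℂ) else 0) (fun r => if c r = j then (1 : ℂ) else 0) z' := by
  have hmem : ∀ h : ι → ℂ, (h ∘ c) ∈ P.fibreConst d := by
    intro h
    have : h ∘ c = ∑ i, h i • fun z => if c z = i then (1 : ℂ) else 0 := by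
      funext z
      simp [Finset.sum_apply]
    rw [this]
    exact Submodule.sum_mem _ fun i _ => Submodule.smul_mem _ _ (hft i)
  have hext : ∀ h : ι → ℂ, ∀ g, Function.extend d (P.ft (h ∘ c)) 0 (d g) = P.ft (h ∘ c) g := by
    intro h g
    exact Function.FactorsThrough.extend_apply (fun g g' hg => hmem h g g' hg) 0 g
  let L : (ι → ℂ) →ₗ[ℂ] (κ → ℂ) :=
    { toFun := fun h => Function.extend d (P.ft (h ∘ c)) 0
      map_add' := by
        intro h h'
        have : (h + h') ∘ c = h ∘ c + h' ∘ c := rfl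
        rw [this, ft_add, ← Function.extend_add]
        simp
      map_smul' := by
        intro r h
        have : (r • h) ∘ c = r • (h ∘ c) := rfl
        rw [this, ft_smul, RingHom.id_apply, ← Function.extend_smul]
        simp }
  have hL : ∀ h g, L h (d g) = P.ft (h ∘ c) g := hext
  have hinj : Function.Injective L := by
    intro h h' hh
    have h1 : P.ft (h ∘ c) = P.ft (h' ∘ c) := by
      funext g
      rw [← hL, ← hL, hh]
    exact hc.injective_comp_right (P.ft_injective h1)
  have hsurj : Function.Surjective L :=
    (LinearMap.injective_iff_surjective_of_finrank_eq_finrank (by simpa using hcard)).mp hinj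
  set φ : ι → G → ℂ := fun i z => if c z = i then 1 else 0
  obtain ⟨k, hk⟩ := hsurj (L (Pi.single i 1) * L (Pi.single j 1))
  have hs : ∀ i, (Pi.single i (1 : ℂ) : ι → ℂ) ∘ c = φ i := by
    intro i
    funext z
    simp [φ, Pi.single_apply]
  have : P.ft (conv (φ i) (φ j)) = P.ft (k ∘ c) := by
    funext g
    rw [ft_conv, ← hL, hk, Pi.mul_apply, hL, hL, hs, hs]
  have h2 := P.ft_injective this
  change conv (φ i) (φ j) z = conv (φ i) (φ j) z'
  rw [h2]
  simp [hz]

end SelfPairing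

end Fourier

section Cubic

/-- An additive character of a field which is invariant under squaring and takes the value `-1`
at `1`; for a finite field of odd degree over `𝔽₂` this is `x ↦ (-1) ^ Tr x`. -/
structure TraceChar (F : Type*) [Field F] where
  /-- The underlying additive character. -/
  χ : AddChar F ℂ
  map_sq : ∀ x, χ (x ^ 2) = χ x
  map_one : χ 1 = -1

variable {F : Type*} [Field F] [Fintype F] [CharP F 2]

omit [CharP F 2] in
lemma exists_cube_eq {m : ℕ} (hm : Odd m) (hF : Fintype.card F = 2 ^ m) (x : F) :
    ∃ y, y ^ 3 = x := by
  obtain ⟨n, rfl⟩ := hm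
  have h4 : 4 ^ n % 3 = 1 := by simp [Nat.pow_mod]
  have hq : Fintype.card F = 2 * 4 ^ n := by rw [hF, pow_succ, pow_mul]; norm_num [mul_comm]
  obtain ⟨j, hj⟩ : ∃ j, Fintype.card F - 1 = 3 * j + 1 := ⟨(2 * 4 ^ n - 1) / 3, by omega⟩
  rcases eq_or_ne x 0 with rfl | hx
  · exact ⟨0, by simp⟩
  · refine ⟨x ^ (2 * j + 1), ?_⟩
    have h1 := FiniteField.pow_card_sub_one_eq_one x hx
    rw [hj] at h1
    calc (x ^ (2 * j + 1)) ^ 3 = (x ^ (3 * j + 1)) ^ 2 * x := by ring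
      _ = x := by rw [h1]; simp

lemma bijective_sq : Function.Bijective (fun x : F => x ^ 2) :=
  Finite.injective_iff_bijective.mp (frobenius_inj F 2)

/-- The roots of the cubic `w³ + α²w + b`. -/
noncomputable def cubicRoots (α b : F) : Finset F :=
  Finset.univ.filter fun w => w ^ 3 + α ^ 2 * w = b

omit [CharP F 2] in
lemma mem_cubicRoots {α b w : F} : w ∈ cubicRoots α b ↔ w ^ 3 + α ^ 2 * w = b := by
  simp [cubicRoots]

namespace TraceChar

variable (t : TraceChar F)

omit [Fintype F] in
lemma mul_self_eq_one (x : F) : t.χ x * t.χ x = 1 := by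
  rw [← AddChar.map_add_eq_mul, CharTwo.add_self_eq_zero, AddChar.map_zero_eq_one]

omit [Fintype F] in
lemma eq_one_or (x : F) : t.χ x = 1 ∨ t.χ x = -1 := mul_self_eq_one_iff.mp (t.mul_self_eq_one x)

omit [Fintype F] [CharP F 2] in
lemma isPrimitive : t.χ.IsPrimitive := by
  refine AddChar.IsPrimitive.of_ne_one ?_
  intro h
  have h1 := t.map_one
  rw [h] at h1
  norm_num at h1

lemma sum_sq_mul (k : F) :
    ∑ z, t.χ (z ^ 2 * k) = if k = 0 then (Fintype.card F : ℂ) else 0 := by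
  rw [bijective_sq.sum_comp fun z => t.χ (z * k), AddChar.sum_mulShift k t.isPrimitive]
  split_ifs <;> simp

omit [Fintype F] in
lemma map_sq_add_self (z : F) : t.χ (z ^ 2 + z) = 1 := by
  rw [AddChar.map_add_eq_mul, t.map_sq, t.mul_self_eq_one]

lemma exists_sq_add_self {c : F} (hc : t.χ c = 1) : ∃ z, z ^ 2 + z = c := by
  by_contra! hne
  have h1 : ∀ z, ∑ y, t.χ (y * (z ^ 2 + z + c)) = 0 := by
    intro z
    rw [AddChar.sum_mulShift _ t.isPrimitive, if_neg]
    · simp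
    · intro h
      exact hne z (CharTwo.add_eq_zero.mp h)
  have h2 : ∀ y z, t.χ (y * (z ^ 2 + z + c)) = t.χ (y * c) * t.χ (z ^ 2 * (y + y ^ 2)) := by
    intro y z
    have h3 : y * (z ^ 2 + z + c) = y * c + z ^ 2 * y + y * z := by ring
    rw [h3, AddChar.map_add_eq_mul _ _ (y * z), ← t.map_sq (y * z), ← AddChar.map_add_eq_mul,
      ← AddChar.map_add_eq_mul]
    congr 1
    ring
  have h3 : ∑ z, ∑ y, t.χ (y * (z ^ 2 + z + c)) = 0 := Finset.sum_eq_zero fun z _ => h1 z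
  rw [Finset.sum_comm] at h3
  simp only [h2, ← Finset.mul_sum, t.sum_sq_mul] at h3
  have h4 : ∀ y : F, y + y ^ 2 = 0 ↔ y ∈ ({0, 1} : Finset F) := by
    intro y
    have : y + y ^ 2 = y * (y + 1) := by ring
    rw [this, mul_eq_zero, CharTwo.add_eq_zero]
    simp
  simp only [mul_ite, mul_zero, h4] at h3
  rw [← Finset.sum_filter, Finset.filter_mem_eq_inter, Finset.univ_inter,
    Finset.sum_pair zero_ne_one] at h3
  simp only [zero_mul, AddChar.map_zero_eq_one, one_mul, hc] at h3
  have : (Fintype.card F : ℂ) ≠ 0 := by exact_mod_cast Fintype.card_ne_zero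
  apply this
  linear_combination h3 / 2

/-- The sum of `χ(α/w)` over the nonzero roots of `w³ + α²w + b`. -/
noncomputable def rootSum (α b : F) : ℂ := ∑ w ∈ (cubicRoots α b).filter (· ≠ 0), t.χ (α / w)

/-- The sum of `χ(bw³)` over the solutions of `bw = α²`. -/
noncomputable def linSum (α b : F) : ℂ :=
  ∑ w ∈ Finset.univ.filter (fun w => b * w = α ^ 2), t.χ (b * w ^ 3)

omit [CharP F 2] in
lemma linSum_eq (α : F) {b : F} (hb : b ≠ 0) : t.linSum α b = t.χ (α ^ 3 / b) := by
  have : (Finset.univ.filter fun w => b * w = α ^ 2) = {α ^ 2 / b} := by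
    ext w
    simp only [Finset.mem_filter, Finset.mem_univ, true_and, Finset.mem_singleton]
    rw [eq_div_iff hb, mul_comm]
  rw [linSum, this, Finset.sum_singleton, ← t.map_sq (α ^ 3 / b)]
  congr 1
  field_simp

lemma exists_root (hcube : ∀ x : F, ∃ y, y ^ 3 = x) {α b : F} (hb : b ≠ 0)
    (h : t.χ (α ^ 3 / b) = 1) : ∃ w, w ^ 3 + α ^ 2 * w = b := by
  have h2 : (2 : F) = 0 := CharTwo.two_eq_zero
  rcases eq_or_ne α 0 with rfl | hα
  · obtain ⟨y, hy⟩ := hcube b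
    exact ⟨y, by simp [hy]⟩
  · rw [← t.map_sq] at h
    obtain ⟨u, hu⟩ := t.exists_sq_add_self h
    obtain ⟨z, hz⟩ := hcube (b / α ^ 3 * u)
    have hv : (z ^ 3) ^ 2 + b / α ^ 3 * z ^ 3 = 1 := by
      rw [hz]
      have : (b / α ^ 3 * u) ^ 2 + b / α ^ 3 * (b / α ^ 3 * u) = (b / α ^ 3) ^ 2 * (u ^ 2 + u) := by
        ring
      rw [this, hu]
      field_simp
    have hz0 : z ≠ 0 := by
      rintro rfl
      simp at hv
    refine ⟨α * (z + 1 / z), ?_⟩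
    field_simp at hv ⊢
    linear_combination hv + (2 * α ^ 3 * z ^ 2 + 2 * α ^ 3 * z ^ 4 - b * z ^ 3 + α ^ 3) * h2

omit [Fintype F] in
lemma map_div_eq_neg_one {α b x y : F} (hx0 : x ≠ 0) (hx : x ^ 3 + α ^ 2 * x = b)
    (hy : y ^ 3 + α ^ 2 * y = b) (hxy : y ≠ x) : t.χ (α / x) = -1 := by
  have h2 : (2 : F) = 0 := CharTwo.two_eq_zero
  have h3 : (y - x) * (y ^ 2 + x * y + x ^ 2 + α ^ 2) = 0 := by
    linear_combination hy - hx
  have h4 := (mul_eq_zero.mp h3).resolve_left (sub_ne_zero.mpr hxy)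
  have h5 : (y / x) ^ 2 + y / x = 1 + (α / x) ^ 2 := by
    field_simp
    linear_combination h4 - (x ^ 2 + α ^ 2) * h2
  have h6 := t.map_sq_add_self (y / x)
  rw [h5, AddChar.map_add_eq_mul, t.map_sq, t.map_one] at h6
  linear_combination -h6

lemma cubic_trichotomy (hcube : ∀ x : F, ∃ y, y ^ 3 = x) (α : F) {b : F} (hb : b ≠ 0) :
    (cubicRoots α b = ∅ ∧ t.rootSum α b = 0 ∧ t.linSum α b = -1) ∨
    ((cubicRoots α b).card = 1 ∧ t.rootSum α b = 1 ∧ t.linSum α b = 1) ∨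
    ((cubicRoots α b).card = 3 ∧ t.rootSum α b = -3 ∧ t.linSum α b = -1) := by
  have h2 : (2 : F) = 0 := CharTwo.two_eq_zero
  have hne : ∀ {w : F}, w ^ 3 + α ^ 2 * w = b → w ≠ 0 := by
    rintro w hw rfl
    exact hb (by simpa using hw.symm)
  have hsum : t.rootSum α b = ∑ w ∈ cubicRoots α b, t.χ (α / w) := by
    rw [rootSum, Finset.filter_true_of_mem]
    intro w hw
    exact hne (mem_cubicRoots.mp hw)
  rw [hsum, t.linSum_eq α hb]
  by_cases hroot : ∃ x, x ^ 3 + α ^ 2 * x = b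
  · obtain ⟨x, hx⟩ := hroot
    have hx0 := hne hx
    have hxα : x + α ≠ 0 := by
      intro h
      apply hb
      linear_combination -hx + x * (x + α) * h - x ^ 2 * α * h2
    have hlin : t.χ (α ^ 3 / b) = t.χ (α / x) := by
      have h3 : α ^ 3 / b = α / x + ((α / (x + α)) ^ 2 + α / (x + α)) := by
        have hb' : b = x * (x + α) ^ 2 := by linear_combination -hx - x ^ 2 * α * h2
        rw [hb']
        field_simp
        linear_combination (-α * x ^ 2 - 2 * α ^ 2 * x) * h2
      rw [h3, AddChar.map_add_eq_mul, t.map_sq_add_self, mul_one]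
    rw [hlin]
    rcases t.eq_one_or (α / x) with h1 | h1
    · have hs : cubicRoots α b = {x} := by
        ext y
        rw [mem_cubicRoots, Finset.mem_singleton]
        refine ⟨fun hy => ?_, fun hy => hy ▸ hx⟩
        by_contra hyx
        have := t.map_div_eq_neg_one hx0 hx hy hyx
        rw [h1] at this
        norm_num at this
      right; left
      rw [hs]
      simp [h1]
    · have hz : t.χ (1 + (α / x) ^ 2) = 1 := by
        rw [AddChar.map_add_eq_mul, t.map_sq, t.map_one, h1]
        norm_num
      obtain ⟨z, hz⟩ := t.exists_sq_add_self hz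
      have hquad : (x * z) ^ 2 + x * (x * z) + x ^ 2 + α ^ 2 = 0 := by
        field_simp at hz
        linear_combination hz + (x ^ 2 + α ^ 2) * h2
      have hz0 : z ≠ 0 := by
        rintro rfl
        apply hxα
        apply (pow_eq_zero_iff two_ne_zero).mp
        linear_combination hquad + x * α * h2
      have hz1 : z ≠ 1 := by
        rintro rfl
        apply hxα
        apply (pow_eq_zero_iff two_ne_zero).mp
        linear_combination hquad + (x * α - x ^ 2) * h2
      have hs : cubicRoots α b = {x, x * z, x * (z + 1)} := by
        ext y
        simp only [mem_cubicRoots, Finset.mem_insert, Finset.mem_singleton]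
        have h3 : y ^ 3 + α ^ 2 * y - b = (y - x) * ((y - x * z) * (y - x * (z + 1))) := by
          linear_combination hx - (y - x) * hquad +
            (y - x) * (x * y + x * y * z - x ^ 2 * z ^ 2 - x ^ 2 * z) * h2 +
            (y - x) * (x ^ 2 + x ^ 2 * z + x ^ 2 * z ^ 2 + α ^ 2) * h2
        rw [← sub_eq_zero, h3]
        simp [sub_eq_zero]
      have ha : x ≠ x * z := fun h => hz1 (mul_left_cancel₀ hx0 (by rw [← h, mul_one]))
      have hb' : x ≠ x * (z + 1) := by
        intro h
        exact hz0 (by simpa [hx0] using mul_left_cancel₀ hx0 ((mul_one x).trans h))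
      have hc : x * z ≠ x * (z + 1) := by
        intro h
        have := mul_left_cancel₀ hx0 h
        simp at this
      have hall : ∀ y ∈ cubicRoots α b, t.χ (α / y) = -1 := by
        intro y hy
        rw [mem_cubicRoots] at hy
        by_cases hyx : y = x
        · rw [hyx, h1]
        · exact t.map_div_eq_neg_one (hne hy) hy hx (Ne.symm hyx)
      have hcard : (cubicRoots α b).card = 3 := by
        rw [hs]
        exact Finset.card_eq_three.mpr ⟨_, _, _, ha, hb', hc, rfl⟩
      right; right
      refine ⟨hcard, ?_, h1⟩
      rw [Finset.sum_congr rfl hall]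
      simp [hcard]
  · have hs : cubicRoots α b = ∅ := by
      ext y
      simp only [mem_cubicRoots, Finset.notMem_empty, iff_false]
      exact fun hy => hroot ⟨y, hy⟩
    left
    refine ⟨hs, by simp [hs], ?_⟩
    exact (t.eq_one_or _).resolve_left fun h => hroot (t.exists_root hcube hb h)

end TraceChar

end Cubic

section PlaneTransform

variable {F : Type*} [Field F] [Fintype F]

namespace TraceChar

variable (t : TraceChar F)

/-- The Fourier transform on `F × F` attached to `χ`. -/
noncomputable def hat (φ : F → F → ℂ) (D B : F) : ℂ :=
  ∑ α, ∑ b, φ α b * (t.χ (α * D) * t.χ (b * B))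

/-- The indicator of the set of pairs `(α, b)` for which `w³ + α²w + b` has no root. -/
noncomputable def rootless (α b : F) : ℂ := if cubicRoots α b = ∅ then 1 else 0

lemma hat_sum_roots (f : F → F → ℂ) (D B : F) :
    t.hat (fun α b => ∑ w ∈ cubicRoots α b, f α w) D B =
      ∑ w, ∑ α, f α w * (t.χ (α * D) * t.χ ((w ^ 3 + α ^ 2 * w) * B)) := by
  rw [hat, Finset.sum_comm (γ := F)]
  conv_rhs => rw [Finset.sum_comm]
  rw [Finset.sum_comm]
  refine Finset.sum_congr rfl fun α _ => ?_
  simp only [cubicRoots, Finset.sum_filter, Finset.sum_mul, ite_mul, zero_mul]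
  rw [Finset.sum_comm]
  simp

omit [Fintype F] in
lemma map_mul_sq (x y : F) : t.χ (x * y) = t.χ (x ^ 2 * y ^ 2) := by
  rw [← t.map_sq, mul_pow]

variable [CharP F 2]

lemma hat_card_roots (D B : F) :
    t.hat (fun α b => (cubicRoots α b).card) D B = Fintype.card F * t.linSum D B := by
  have h := t.hat_sum_roots (fun _ _ => 1) D B
  simp only [Finset.sum_const, nsmul_eq_mul, mul_one, one_mul] at h
  rw [h]
  have h1 : ∀ w α : F, t.χ (α * D) * t.χ ((w ^ 3 + α ^ 2 * w) * B) =
      t.χ (B * w ^ 3) * t.χ (α ^ 2 * (D ^ 2 + B * w)) := by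
    intro w α
    rw [t.map_mul_sq α, ← AddChar.map_add_eq_mul, ← AddChar.map_add_eq_mul]
    congr 1
    ring
  simp only [h1, ← Finset.mul_sum, t.sum_sq_mul, linSum, Finset.sum_filter]
  rw [Finset.mul_sum]
  refine Finset.sum_congr rfl fun w _ => ?_
  rw [CharTwo.add_eq_zero, eq_comm (a := D ^ 2)]
  split_ifs <;> ring

lemma hat_rootSum (D B : F) :
    t.hat t.rootSum D B = -(Fintype.card F * t.rootSum D B) := by
  have h2 : (2 : F) = 0 := CharTwo.two_eq_zero
  have h := t.hat_sum_roots (fun α w => if w ≠ 0 then t.χ (α / w) else 0) D B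
  simp only [← Finset.sum_filter] at h
  change t.hat t.rootSum D B = _ at h
  rw [h, ← Equiv.sum_comp (Equiv.inv F), rootSum, Finset.sum_filter, cubicRoots,
    Finset.sum_filter, Finset.mul_sum, ← Finset.sum_neg_distrib]
  refine Finset.sum_congr rfl fun x _ => ?_
  rcases eq_or_ne x 0 with rfl | hx
  · simp
  · have h1 : ∀ α : F, t.χ (α / x⁻¹) *
        (t.χ (α * D) * t.χ (((x⁻¹) ^ 3 + α ^ 2 * x⁻¹) * B)) =
        t.χ (B / x ^ 3) * t.χ (α ^ 2 * (x ^ 2 + D ^ 2 + B / x)) := by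
      intro α
      rw [t.map_mul_sq α, ← t.map_sq (α / x⁻¹), ← AddChar.map_add_eq_mul,
        ← AddChar.map_add_eq_mul, ← AddChar.map_add_eq_mul]
      congr 1
      field_simp
      ring
    have h3 : x ^ 2 + D ^ 2 + B / x = 0 ↔ x ^ 3 + D ^ 2 * x = B := by
      rw [CharTwo.add_eq_zero, eq_div_iff hx]
      constructor <;> intro h <;> linear_combination h
    simp only [Equiv.inv_apply, ne_eq, inv_eq_zero, hx, not_false_eq_true, if_true, h1,
      ← Finset.mul_sum, t.sum_sq_mul, h3]
    split_ifs with hB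
    · have h4 : t.χ (B / x ^ 3) = - t.χ (D / x) := by
        have : B / x ^ 3 = 1 + (D / x) ^ 2 := by
          rw [← hB]
          field_simp
        rw [this, AddChar.map_add_eq_mul, t.map_sq, t.map_one]
        ring
      rw [h4]
      ring
    · simp

lemma cubicRoots_zero (α : F) : cubicRoots α 0 = {0, α} := by
  ext w
  have : w ^ 3 + α ^ 2 * w = w * (w + α) ^ 2 := by
    linear_combination (-w ^ 2 * α) * (CharTwo.two_eq_zero : (2 : F) = 0)
  rw [mem_cubicRoots, this]
  simp [CharTwo.add_eq_zero]

lemma rootSum_zero_zero : t.rootSum 0 0 = 0 := by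
  rw [rootSum, cubicRoots_zero]
  simp [Finset.filter_singleton]

lemma rootSum_right_zero {α : F} (hα : α ≠ 0) : t.rootSum α 0 = -1 := by
  have : ({0, α} : Finset F).filter (· ≠ 0) = {α} := by
    ext w
    simp only [Finset.mem_filter, Finset.mem_insert, Finset.mem_singleton]
    constructor
    · rintro ⟨h | h, h'⟩
      · exact absurd h h'
      · exact h
    · rintro rfl
      exact ⟨Or.inr rfl, hα⟩
  rw [rootSum, cubicRoots_zero, this, Finset.sum_singleton, div_self hα, t.map_one]

omit [CharP F 2] in
lemma linSum_right_zero {α : F} (hα : α ≠ 0) : t.linSum α 0 = 0 := by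
  rw [linSum, Finset.filter_false_of_mem, Finset.sum_empty]
  intro w _
  simpa using (pow_ne_zero 2 hα).symm

variable (hcube : ∀ x : F, ∃ y, y ^ 3 = x)
include hcube

lemma three_mul_rootless (α b : F) :
    3 * rootless α b = 3 - 2 * (cubicRoots α b).card - t.rootSum α b -
      (if α = 0 ∧ b = 0 then 1 else 0) := by
  rcases eq_or_ne b 0 with rfl | hb
  · rw [rootless, cubicRoots_zero]
    rcases eq_or_ne α 0 with rfl | hα
    · rw [t.rootSum_zero_zero]
      norm_num
    · rw [t.rootSum_right_zero hα, Finset.card_pair hα.symm]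
      simp [hα]
      norm_num
  · rcases t.cubic_trichotomy hcube α hb with ⟨h1, h2, -⟩ | ⟨h1, h2, -⟩ | ⟨h1, h2, -⟩
    · simp [rootless, h1, h2, hb]
    all_goals
      have h3 : cubicRoots α b ≠ ∅ := by
        rintro h
        simp [h] at h1
      simp [rootless, h1, h2, h3, hb]
      try norm_num

lemma rootSum_sub_linSum {D B : F} (h : ¬ (D = 0 ∧ B = 0)) :
    t.rootSum D B - 2 * t.linSum D B = 3 * rootless D B - 1 := by
  rcases eq_or_ne B 0 with rfl | hB
  · have hD : D ≠ 0 := fun h' => h ⟨h', rfl⟩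
    rw [t.rootSum_right_zero hD, t.linSum_right_zero hD, rootless, cubicRoots_zero]
    simp
  · rcases t.cubic_trichotomy hcube D hB with ⟨h1, h2, h3⟩ | ⟨h1, h2, h3⟩ | ⟨h1, h2, h3⟩
    · simp [rootless, h1, h2, h3]
      norm_num
    all_goals
      have h4 : cubicRoots D B ≠ ∅ := by
        rintro h
        simp [h] at h1
      simp [rootless, h2, h3, h4]
      norm_num

omit [CharP F 2] hcube in
lemma hat_one (D B : F) : t.hat (fun _ _ => 1) D B =
    if D = 0 ∧ B = 0 then (Fintype.card F : ℂ) ^ 2 else 0 := by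
  simp only [hat, one_mul, ← Finset.mul_sum, ← Finset.sum_mul,
    AddChar.sum_mulShift _ t.isPrimitive]
  by_cases h1 : D = 0 <;> by_cases h2 : B = 0 <;> simp [h1, h2, sq]

omit [CharP F 2] hcube in
lemma hat_line (D B : F) : t.hat (fun _ b => if b = 0 then 1 else 0) D B =
    if D = 0 then (Fintype.card F : ℂ) else 0 := by
  simp [hat, AddChar.sum_mulShift _ t.isPrimitive]

omit [CharP F 2] hcube in
lemma hat_origin (D B : F) : t.hat (fun α b => if α = 0 ∧ b = 0 then 1 else 0) D B = 1 := by
  simp [hat, ite_and]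

lemma three_mul_hat_rootless {D B : F} (h : ¬ (D = 0 ∧ B = 0)) :
    3 * t.hat rootless D B = Fintype.card F * (3 * rootless D B - 1) - 1 := by
  have h1 : 3 * t.hat rootless D B = 3 * t.hat (fun _ _ => 1) D B -
      2 * t.hat (fun α b => (cubicRoots α b).card) D B - t.hat t.rootSum D B -
      t.hat (fun α b => if α = 0 ∧ b = 0 then 1 else 0) D B := by
    simp only [hat, Finset.mul_sum, ← Finset.sum_sub_distrib]
    refine Finset.sum_congr rfl fun α _ => Finset.sum_congr rfl fun b _ => ?_
    rw [← mul_assoc, t.three_mul_rootless hcube]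
    ring
  rw [h1, t.hat_one, t.hat_card_roots, t.hat_rootSum, t.hat_origin, if_neg h,
    ← t.rootSum_sub_linSum hcube h]
  ring

/-- The block of the partition of `F × F` containing `(D, B)`. -/
noncomputable def planeBlock (D B : F) : Fin 4 :=
  if D = 0 then (if B = 0 then 0 else 1) else if cubicRoots D B = ∅ then 2 else 3

lemma hat_rootless_congr {D B D' B' : F} (h : planeBlock D B = planeBlock D' B') :
    t.hat rootless D B = t.hat rootless D' B' := by
  have h0 : ∀ {b : F}, b ≠ 0 → rootless 0 b = 0 := by
    intro b _
    obtain ⟨y, hy⟩ := hcube b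
    rw [rootless, if_neg]
    exact Finset.nonempty_iff_ne_empty.mp ⟨y, by simp [mem_cubicRoots, hy]⟩
  have key : ∀ {D B D' B' : F}, ¬ (D = 0 ∧ B = 0) → ¬ (D' = 0 ∧ B' = 0) →
      rootless D B = rootless D' B' → t.hat rootless D B = t.hat rootless D' B' := by
    intro D B D' B' h1 h2 h3
    have := t.three_mul_hat_rootless hcube h1
    have h4 := t.three_mul_hat_rootless hcube h2
    rw [h3, ← h4] at this
    exact mul_left_cancel₀ three_ne_zero this
  unfold planeBlock at h
  split_ifs at h with h1 h2 h3 h4 h5 h6 h7 h8 h9 h10 h11 h12 h13 h14 h15 <;>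
    first
    | (exact absurd h (by decide))
    | (subst_vars; rfl)
    | (refine key (by tauto) (by tauto) ?_; subst_vars; simp [rootless, *]; done)
    | (refine key (by tauto) (by tauto) ?_; subst_vars; rw [h0 (by assumption), h0 (by assumption)])

end TraceChar

end PlaneTransform

section QuaternaryExponent

/-- The additive character `x ↦ i ^ x` of `ℤ/4ℤ`. -/
noncomputable def iPow : AddChar (ZMod 4) ℂ := AddChar.zmodChar 4 Complex.I_pow_four

/-- The real part of `i ^ x`. -/
def rePow (x : ZMod 4) : ℤ := 1 - symWt x

/-- The imaginary part of `i ^ x`. -/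
def imPow (x : ZMod 4) : ℤ := rePow (x - 1)

lemma iPow_one : iPow 1 = Complex.I := by
  have : (1 : ZMod 4).val = 1 := rfl
  simp [iPow, AddChar.zmodChar_apply, this]

lemma iPow_eq (x : ZMod 4) : iPow x = rePow x + imPow x * Complex.I := by
  have h2 : iPow 2 = -1 := by
    rw [← one_add_one_eq_two, AddChar.map_add_eq_mul, iPow_one, Complex.I_mul_I]
  have h3 : iPow 3 = -Complex.I := by
    rw [show (3 : ZMod 4) = 2 + 1 from rfl, AddChar.map_add_eq_mul, iPow_one, h2, neg_one_mul]
  have cases : x = 0 ∨ x = 1 ∨ x = 2 ∨ x = 3 := by revert x; decide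
  have r0 : rePow 0 = 1 := by decide
  have r1 : rePow 1 = 0 := by decide
  have r2 : rePow 2 = -1 := by decide
  have r3 : rePow 3 = 0 := by decide
  have i0 : imPow 0 = 0 := by decide
  have i1 : imPow 1 = 1 := by decide
  have i2 : imPow 2 = 0 := by decide
  have i3 : imPow 3 = -1 := by decide
  rcases cases with rfl | rfl | rfl | rfl
  · simp [r0, i0]
  · simp [r1, i1, iPow_one]
  · simp [r2, i2, h2]
  · simp [r3, i3, h3]

lemma rePow_neg (x : ZMod 4) : rePow (-x) = rePow x := by revert x; decide

lemma imPow_neg (x : ZMod 4) : imPow (-x) = -imPow x := by revert x; decide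

lemma rePow_one_add (x : ZMod 4) : rePow (1 + x) = -imPow x := by revert x; decide

lemma imPow_one_add (x : ZMod 4) : imPow (1 + x) = rePow x := by revert x; decide

lemma iPow_ne_one {s : ZMod 4} (hs : s ≠ 0) : iPow s ≠ 1 := by
  intro h
  rw [iPow_eq] at h
  have h1 := congrArg Complex.re h
  simp only [Complex.add_re, Complex.intCast_re, Complex.mul_re, Complex.I_re, mul_zero,
    Complex.intCast_im, Complex.I_im, mul_one, sub_self, add_zero, Complex.one_re] at h1
  have h2 : rePow s = 1 := by exact_mod_cast h1
  clear h h1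
  revert s
  decide

lemma iPow_isPrimitive : iPow.IsPrimitive := by
  intro u hu h
  have := DFunLike.congr_fun h 1
  rw [AddChar.mulShift_apply, mul_one, AddChar.one_apply] at this
  exact iPow_ne_one hu this

end QuaternaryExponent

section TwoSquares

lemma even_of_sq_add_sq {x y c : ℤ} (h : x ^ 2 + y ^ 2 = 4 * c) :
    ∃ a b, x = 2 * a ∧ y = 2 * b ∧ a ^ 2 + b ^ 2 = c := by
  rcases Int.even_or_odd' x with ⟨a, rfl | rfl⟩ <;> rcases Int.even_or_odd' y with ⟨b, rfl | rfl⟩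
  · exact ⟨a, b, rfl, rfl, by linarith⟩
  all_goals
    exfalso
    ring_nf at h
    omega

lemma sq_eq_of_sq_add_sq_eq_two_mul (n : ℕ) {x y : ℤ} (h : x ^ 2 + y ^ 2 = 2 * 4 ^ n) :
    x ^ 2 = 4 ^ n := by
  induction n generalizing x y with
  | zero =>
    have h1 : -1 ≤ x := by nlinarith
    have h2 : x ≤ 1 := by nlinarith
    have h3 : -1 ≤ y := by nlinarith
    have h4 : y ≤ 1 := by nlinarith
    interval_cases x <;> interval_cases y <;> simp_all
  | succ n ih =>
    obtain ⟨a, b, rfl, rfl, hab⟩ := even_of_sq_add_sq (c := 2 * 4 ^ n) (by rw [h]; ring)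
    rw [mul_pow, ih hab]
    ring

lemma sq_eq_of_sq_add_sq_eq (n : ℕ) {x y : ℤ} (h : x ^ 2 + y ^ 2 = 4 ^ n) :
    (x = 0 ∧ y ^ 2 = 4 ^ n) ∨ (x ^ 2 = 4 ^ n ∧ y = 0) := by
  induction n generalizing x y with
  | zero =>
    have h1 : -1 ≤ x := by nlinarith
    have h2 : x ≤ 1 := by nlinarith
    have h3 : -1 ≤ y := by nlinarith
    have h4 : y ≤ 1 := by nlinarith
    interval_cases x <;> interval_cases y <;> simp_all
  | succ n ih =>
    obtain ⟨a, b, rfl, rfl, hab⟩ := even_of_sq_add_sq (c := 4 ^ n) (by rw [h]; ring)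
    rcases ih hab with ⟨h1, h2⟩ | ⟨h1, h2⟩
    · left
      exact ⟨by rw [h1]; rfl, by rw [mul_pow, h2]; ring⟩
    · right
      exact ⟨by rw [mul_pow, h1]; ring, by rw [h2]; rfl⟩

lemma eq_or_eq_neg_two_pow {n : ℕ} {x : ℤ} (h : x ^ 2 = 4 ^ n) : x = 2 ^ n ∨ x = -2 ^ n := by
  apply sq_eq_sq_iff_eq_or_eq_neg.mp
  rw [h, ← pow_mul, mul_comm, pow_mul]
  norm_num

end TwoSquares

section Galois

/-- A finite ring `R` of characteristic dividing `4` whose residue field `R / 2R` is `F`, together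
with a lift `τ` of the residue map whose squares are the squares of `R`, and a `ℤ/4ℤ`-valued trace
which reduces to a trace of `F`. -/
structure GaloisData (R F : Type*) [CommRing R] [Field F] where
  /-- The residue map. -/
  π : R →+* F
  /-- The trace. -/
  T : R →+ ZMod 4
  /-- The trace character of the residue field. -/
  t : TraceChar F
  /-- The Teichmüller lift. -/
  τ : F → R
  four_eq_zero : (4 : R) = 0
  ker : ∀ z, π z = 0 → ∃ w, z = 2 * w
  π_τ : ∀ x, π (τ x) = x
  sq_eq : ∀ z, z ^ 2 = τ (π z ^ 2)
  χ_π : ∀ z, iPow (T (2 * z)) = t.χ (π z)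

namespace GaloisData

variable {R F : Type*} [CommRing R] [Fintype R] [Field F] [Fintype F] [CharP F 2]
  (D : GaloisData R F)

omit [Fintype R] [Fintype F] in
lemma π_two_mul (w : R) : D.π (2 * w) = 0 := by
  rw [map_mul, map_ofNat, CharTwo.two_eq_zero, zero_mul]

omit [Fintype R] [Fintype F] [CharP F 2] in
lemma exists_π (x : F) : ∃ z, D.π z = x := ⟨D.τ x, D.π_τ x⟩

omit [Fintype R] [Fintype F] [CharP F 2] in
lemma τ_sq (x : F) : D.τ (x ^ 2) = D.τ x ^ 2 := by rw [D.sq_eq, D.π_τ]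

omit [Fintype R] [Fintype F] [CharP F 2] in
lemma τ_zero : D.τ 0 = 0 := by
  have := D.sq_eq 0
  simpa using this.symm

omit [Fintype R] [Fintype F] in
lemma τ_add_of_sq (x y : F) :
    D.τ (x ^ 2 + y ^ 2) = D.τ (x ^ 2) + D.τ (y ^ 2) + 2 * (D.τ x * D.τ y) := by
  have h := D.sq_eq (D.τ x + D.τ y)
  rw [map_add, D.π_τ, D.π_τ] at h
  rw [← CharTwo.add_sq, ← h, τ_sq, τ_sq]
  ring

/-- The quaternary character attached to the trace. -/
noncomputable def ψ : AddChar R ℂ := iPow.compAddMonoidHom D.T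

omit [Fintype R] [Fintype F] [CharP F 2] in
lemma ψ_apply (a : R) : D.ψ a = iPow (D.T a) := rfl

omit [Fintype R] [Fintype F] [CharP F 2] in
lemma ψ_two_mul (a : R) : D.ψ (2 * a) = D.t.χ (D.π a) := D.χ_π a

omit [Fintype R] [Fintype F] [CharP F 2] in
lemma eq_zero_of_χ {y : F} (h : ∀ x, D.t.χ (y * x) = 1) : y = 0 := by
  by_contra hy
  exact D.t.isPrimitive hy (DFunLike.ext _ _ h)

omit [Fintype R] [Fintype F] [CharP F 2] in
lemma eq_zero_of_ψ {a : R} (h : ∀ A, D.ψ (a * A) = 1) : a = 0 := by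
  have h0 : D.π a = 0 := by
    refine D.eq_zero_of_χ fun x => ?_
    obtain ⟨A, rfl⟩ := D.exists_π x
    rw [← map_mul, ← ψ_two_mul, ← h (2 * A)]
    congr 1
    ring
  obtain ⟨w, rfl⟩ := D.ker a h0
  have h1 : D.π w = 0 := by
    refine D.eq_zero_of_χ fun x => ?_
    obtain ⟨A, rfl⟩ := D.exists_π x
    rw [← map_mul, ← ψ_two_mul, ← h A, mul_assoc]
  obtain ⟨v, rfl⟩ := D.ker w h1
  linear_combination v * D.four_eq_zero

omit [Fintype R] [Fintype F] [CharP F 2] in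
lemma ψ_isPrimitive : D.ψ.IsPrimitive := by
  intro a ha h
  exact ha (D.eq_zero_of_ψ fun A => DFunLike.congr_fun h A)

omit [Fintype R] [Fintype F] [CharP F 2] in
lemma two_mul_eq_zero_iff (w : R) : 2 * w = 0 ↔ D.π w = 0 := by
  constructor
  · intro h
    refine D.eq_zero_of_χ fun x => ?_
    obtain ⟨A, rfl⟩ := D.exists_π x
    rw [← map_mul, ← ψ_two_mul, ← mul_assoc, h, zero_mul, AddChar.map_zero_eq_one]
  · intro h
    obtain ⟨v, rfl⟩ := D.ker w h
    linear_combination v * D.four_eq_zero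

omit [Fintype R] [Fintype F] [CharP F 2] in
lemma two_mul_eq_iff (w v : R) : 2 * w = 2 * v ↔ D.π w = D.π v := by
  rw [← sub_eq_zero, ← mul_sub, D.two_mul_eq_zero_iff, map_sub, sub_eq_zero]

/-- The pairing on `ℤ/4ℤ × R × F` induced by the characters of the factors. -/
noncomputable def pairing : SelfPairing (ZMod 4 × R × F) where
  e z g := iPow (z.1 * g.1) * (D.ψ (z.2.1 * g.2.1) * D.t.χ (z.2.2 * g.2.2))
  add_right z g h := by
    simp only [Prod.fst_add, Prod.snd_add, mul_add, AddChar.map_add_eq_mul]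
    ring
  comm z g := by simp only [mul_comm]
  sum_eq z := by
    have h : ∑ g : ZMod 4 × R × F,
        iPow (z.1 * g.1) * (D.ψ (z.2.1 * g.2.1) * D.t.χ (z.2.2 * g.2.2)) =
        (∑ s : ZMod 4, iPow (s * z.1)) *
          ((∑ A : R, D.ψ (A * z.2.1)) * ∑ B : F, D.t.χ (B * z.2.2)) := by
      rw [Fintype.sum_prod_type, Finset.sum_mul]
      refine Finset.sum_congr rfl fun s _ => ?_
      rw [Fintype.sum_prod_type, Finset.sum_mul, Finset.mul_sum]
      refine Finset.sum_congr rfl fun A _ => ?_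
      rw [Finset.mul_sum, Finset.mul_sum]
      exact Finset.sum_congr rfl fun B _ => by simp only [mul_comm]
    rw [h, AddChar.sum_mulShift _ iPow_isPrimitive, AddChar.sum_mulShift _ D.ψ_isPrimitive,
      AddChar.sum_mulShift _ D.t.isPrimitive]
    obtain ⟨u, a, b⟩ := z
    simp only [Prod.mk_eq_zero, Fintype.card_prod]
    by_cases hu : u = 0 <;> by_cases ha : a = 0 <;> by_cases hb : b = 0 <;> simp [hu, ha, hb]

omit [CharP F 2] in
lemma pairing_apply (z g : ZMod 4 × R × F) : D.pairing.e z g =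
    iPow (z.1 * g.1) * (D.ψ (z.2.1 * g.2.1) * D.t.χ (z.2.2 * g.2.2)) := rfl

/-- The point of the dual group at which a codeword is evaluated in position `x`. -/
def pt (x : F) : ZMod 4 × R × F := (1, D.τ x, x ^ 3)

/-- The entry in position `x` of the codeword with parameters `z`. -/
def phase (z : ZMod 4 × R × F) (x : F) : ZMod 4 :=
  z.1 + D.T (z.2.1 * D.τ x + 2 * D.τ z.2.2 * D.τ x ^ 3)

omit [CharP F 2] in
lemma pairing_pt (z : ZMod 4 × R × F) (x : F) : D.pairing.e z (D.pt x) = iPow (D.phase z x) := by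
  rw [pairing_apply, phase, AddChar.map_add_eq_mul, ← ψ_apply, AddChar.map_add_eq_mul, mul_assoc 2,
    ψ_two_mul, map_mul D.π, map_pow D.π, D.π_τ, D.π_τ]
  simp [pt]

omit [CharP F 2] in
lemma pairing_neg_left (z g : ZMod 4 × R × F) :
    D.pairing.e (-z) g = D.pairing.e z (-g) := by
  simp [pairing_apply]

omit [Fintype R] [Fintype F] [CharP F 2] in
lemma phase_neg (z : ZMod 4 × R × F) (x : F) : D.phase (-z) x = -D.phase z x := by
  have h : 2 * D.τ (-z.2.2) = -(2 * D.τ z.2.2) := by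
    rw [← mul_neg, D.two_mul_eq_iff, map_neg, D.π_τ, D.π_τ]
  simp only [phase, Prod.fst_neg, Prod.snd_neg, h]
  rw [neg_add, ← map_neg]
  congr 2
  ring

omit [Fintype R] [Fintype F] [CharP F 2] in
lemma phase_add_left (s : ZMod 4) (z : ZMod 4 × R × F) (x : F) :
    D.phase (s + z.1, z.2) x = s + D.phase z x := add_assoc _ _ _

omit [CharP F 2] in
lemma pairing_neg_pt (z : ZMod 4 × R × F) (x : F) :
    D.pairing.e z (-D.pt x) = iPow (-D.phase z x) := by
  rw [← pairing_neg_left, pairing_pt, phase_neg]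

/-- The real part of the exponential sum of a codeword. -/
def re (z : ZMod 4 × R × F) : ℤ := ∑ x, rePow (D.phase z x)

/-- The imaginary part of the exponential sum of a codeword. -/
def im (z : ZMod 4 × R × F) : ℤ := ∑ x, imPow (D.phase z x)

omit [Fintype R] [CharP F 2] in
lemma re_neg (z : ZMod 4 × R × F) : D.re (-z) = D.re z := by
  simp only [re, phase_neg, rePow_neg]

omit [Fintype R] [CharP F 2] in
lemma re_one_add (z : ZMod 4 × R × F) : D.re (1 + z.1, z.2) = -D.im z := by
  simp only [re, im, phase_add_left, rePow_one_add, Finset.sum_neg_distrib]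

omit [Fintype R] [CharP F 2] in
lemma im_one_add (z : ZMod 4 × R × F) : D.im (1 + z.1, z.2) = D.re z := by
  simp only [re, im, phase_add_left, imPow_one_add]

omit [Fintype R] [CharP F 2] in
lemma re_two_add (z : ZMod 4 × R × F) : D.re (2 + z.1, z.2) = -D.re z := by
  have h := D.re_one_add (1 + z.1, z.2)
  rw [im_one_add] at h
  rw [← h]
  congr 2
  ring_nf

omit [CharP F 2] in
lemma sum_pairing_pt (z : ZMod 4 × R × F) :
    ∑ x, D.pairing.e z (D.pt x) = D.re z + D.im z * Complex.I := by
  simp only [pairing_pt, iPow_eq, re, im, Int.cast_sum, Finset.sum_mul, Finset.sum_add_distrib]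

omit [CharP F 2] in
lemma sum_pairing_neg_pt (z : ZMod 4 × R × F) :
    ∑ x, D.pairing.e z (-D.pt x) = D.re z - D.im z * Complex.I := by
  simp only [pairing_neg_pt, iPow_eq, rePow_neg, imPow_neg, re, im, Int.cast_sum, Finset.sum_mul,
    Finset.sum_add_distrib, Int.cast_neg, neg_mul, Finset.sum_neg_distrib, sub_eq_add_neg]

/-- The additive polynomial whose kernel is the radical of the form attached to a codeword. -/
def radPoly (α b h : F) : F := α ^ 4 * h ^ 2 + b ^ 2 * h ^ 4 + b * h

/-- The part of a codeword which is multiplicative on the radical. -/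
noncomputable def inner (z : ZMod 4 × R × F) (h : F) : ℂ :=
  D.ψ (z.2.1 * D.τ h) * D.t.χ (z.2.2 * h ^ 3)

omit [Fintype R] in
lemma inner_add (z : ZMod 4 × R × F) (y h : F) : D.inner z (y + h) =
    D.inner z y * D.inner z h * D.t.χ (y ^ 2 * radPoly (D.π z.2.1) z.2.2 h) := by
  obtain ⟨y, rfl⟩ := (bijective_sq (F := F)).2 y
  obtain ⟨h, rfl⟩ := (bijective_sq (F := F)).2 h
  obtain ⟨u, a, b⟩ := z
  simp only [inner, radPoly]
  have h1 : a * D.τ (y ^ 2 + h ^ 2) =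
      a * D.τ (y ^ 2) + a * D.τ (h ^ 2) + 2 * (a * D.τ y * D.τ h) := by
    rw [D.τ_add_of_sq]
    ring
  have h2 : b * (y ^ 2 + h ^ 2) ^ 3 =
      b * (y ^ 2) ^ 3 + b * (h ^ 2) ^ 3 + b * y ^ 4 * h ^ 2 + b * y ^ 2 * h ^ 4 := by
    linear_combination b * (y ^ 4 * h ^ 2 + y ^ 2 * h ^ 4) * CharTwo.two_eq_zero (R := F)
  have h3 : (y ^ 2) ^ 2 * (D.π a ^ 4 * (h ^ 2) ^ 2 + b ^ 2 * (h ^ 2) ^ 4 + b * h ^ 2) =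
      ((D.π a * y * h) ^ 2) ^ 2 + (b * y ^ 2 * h ^ 4) ^ 2 + b * y ^ 4 * h ^ 2 := by ring
  rw [h1, h2, h3]
  simp only [AddChar.map_add_eq_mul, ψ_two_mul, map_mul, D.π_τ, D.t.map_sq]
  ring

omit [CharP F 2] in
lemma pairing_pt_eq_inner (z : ZMod 4 × R × F) (x : F) :
    D.pairing.e z (D.pt x) = iPow z.1 * D.inner z x := by
  simp [pairing_apply, pt, inner]

omit [Fintype R] [Fintype F] [CharP F 2] in
lemma inner_mul_neg (z : ZMod 4 × R × F) (x : F) : D.inner z x * D.inner (-z) x = 1 := by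
  simp only [inner, Prod.snd_neg, Prod.fst_neg, neg_mul]
  rw [mul_mul_mul_comm, ← AddChar.map_add_eq_mul, ← AddChar.map_add_eq_mul]
  simp

/-- The radical of the form attached to a codeword. -/
noncomputable def rad (α b : F) : Finset F := Finset.univ.filter fun h => radPoly α b h = 0

lemma sq_add_sq (z : ZMod 4 × R × F) : ((D.re z ^ 2 + D.im z ^ 2 : ℤ) : ℂ) =
    Fintype.card F * ∑ h ∈ rad (D.π z.2.1) z.2.2, D.inner z h := by
  have h1 : ((D.re z ^ 2 + D.im z ^ 2 : ℤ) : ℂ) =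
      (∑ x, D.pairing.e z (D.pt x)) * ∑ y, D.pairing.e z (-D.pt y) := by
    rw [sum_pairing_pt, sum_pairing_neg_pt]
    push_cast
    linear_combination ((D.im z : ℂ) ^ 2) * Complex.I_sq
  have h2 : ∀ x y, D.pairing.e z (D.pt (x + y)) * D.pairing.e z (-D.pt y) =
      D.inner z x * D.t.χ (y ^ 2 * radPoly (D.π z.2.1) z.2.2 x) := by
    intro x y
    rw [← pairing_neg_left, pairing_pt_eq_inner, pairing_pt_eq_inner, add_comm, inner_add]
    have h3 : iPow z.1 * iPow (-z).1 = 1 := by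
      rw [← AddChar.map_add_eq_mul]
      simp
    linear_combination (D.inner z x * D.t.χ (y ^ 2 * radPoly (D.π z.2.1) z.2.2 x)) *
      (iPow z.1 * iPow (-z).1 * D.inner_mul_neg z y + h3)
  rw [h1, Finset.sum_mul_sum, Finset.sum_comm]
  have h3 : ∀ y, ∑ x, D.pairing.e z (D.pt x) * D.pairing.e z (-D.pt y) =
      ∑ x, D.pairing.e z (D.pt (x + y)) * D.pairing.e z (-D.pt y) := fun y =>
    (Equiv.sum_comp (Equiv.addRight y)
      fun x => D.pairing.e z (D.pt x) * D.pairing.e z (-D.pt y)).symm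
  simp only [h3, h2]
  rw [Finset.sum_comm]
  simp only [← Finset.mul_sum, D.t.sum_sq_mul, mul_ite, mul_zero]
  rw [← Finset.sum_filter, Finset.mul_sum, rad]
  exact Finset.sum_congr rfl fun h _ => mul_comm _ _

end GaloisData

end Galois

section Values

namespace GaloisData

variable {R F : Type*} [CommRing R] [Fintype R] [Field F] [Fintype F] [CharP F 2]
  (D : GaloisData R F)

omit [CharP F 2] in
lemma mem_rad {α b h : F} : h ∈ rad α b ↔ radPoly α b h = 0 := by
  simp [rad]

omit [CharP F 2] in
lemma rad_right_zero {α : F} (hα : α ≠ 0) : rad α 0 = {0} := by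
  ext h
  simp [mem_rad, radPoly, hα]

lemma card_rad (α : F) {b : F} (hb : b ≠ 0) : (rad α b).card = (cubicRoots α b).card + 1 := by
  have hinj : Function.Injective fun w : F => w ^ 2 / b := fun x y h =>
    (bijective_sq (F := F)).1 (by simpa [hb, div_left_inj'] using h)
  have h0 : (0 : F) ∉ (cubicRoots α b).image fun w => w ^ 2 / b := by
    simp only [Finset.mem_image, mem_cubicRoots, div_eq_zero_iff, hb, or_false, not_exists, not_and]
    rintro w hw h
    rw [pow_eq_zero_iff two_ne_zero] at h
    rw [h] at hw
    exact hb (by linear_combination -hw)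
  have key : ∀ w : F, radPoly α b (w ^ 2 / b) = w ^ 2 * ((w ^ 3 + α ^ 2 * w - b) / b) ^ 2 := by
    intro w
    rw [radPoly]
    field_simp
    linear_combination (-w ^ 4 * α ^ 2 + w ^ 3 * b + α ^ 2 * w * b) * w ^ 2 *
      CharTwo.two_eq_zero (R := F)
  have h1 : rad α b = insert 0 ((cubicRoots α b).image fun w => w ^ 2 / b) := by
    ext h
    obtain ⟨w, hw⟩ := (bijective_sq (F := F)).2 (h * b)
    have hw' : h = w ^ 2 / b := by
      rw [eq_div_iff hb]
      exact hw.symm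
    subst hw'
    rw [mem_rad, key, Finset.mem_insert, Finset.mem_image]
    simp only [mul_eq_zero, pow_eq_zero_iff two_ne_zero, div_eq_zero_iff,
      hb, or_false, sub_eq_zero, mem_cubicRoots]
    refine or_congr_right ⟨fun h => ⟨w, h, rfl⟩, ?_⟩
    rintro ⟨v, hv, hvw⟩
    rwa [hinj hvw] at hv
  rw [h1, Finset.card_insert_of_notMem h0, Finset.card_image_of_injective _ hinj]

omit [Fintype R] [Fintype F] [CharP F 2] in
lemma inner_zero (z : ZMod 4 × R × F) : D.inner z 0 = 1 := by
  simp [inner, D.τ_zero]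

omit [CharP F 2] in
lemma zero_mem_rad (α b : F) : 0 ∈ rad α b := by
  simp [mem_rad, radPoly]

lemma add_mem_rad {α b x y : F} (hx : x ∈ rad α b) (hy : y ∈ rad α b) : x + y ∈ rad α b := by
  rw [mem_rad, radPoly] at *
  linear_combination hx + hy + (α ^ 4 * x * y + b ^ 2 * (2 * x ^ 3 * y + 3 * x ^ 2 * y ^ 2 +
    2 * x * y ^ 3)) * CharTwo.two_eq_zero (R := F)

omit [Fintype R] in
lemma sum_inner_rad (z : ZMod 4 × R × F) :
    ∑ h ∈ rad (D.π z.2.1) z.2.2, D.inner z h = 0 ∨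
    ∑ h ∈ rad (D.π z.2.1) z.2.2, D.inner z h = (rad (D.π z.2.1) z.2.2).card := by
  by_cases hall : ∀ h ∈ rad (D.π z.2.1) z.2.2, D.inner z h = 1
  · right
    rw [Finset.sum_congr rfl hall]
    simp
  · left
    push Not at hall
    obtain ⟨k, hk, hk1⟩ := hall
    have h1 : ∑ h ∈ rad (D.π z.2.1) z.2.2, D.inner z h =
        ∑ h ∈ rad (D.π z.2.1) z.2.2, D.inner z h * D.inner z k := by
      refine Finset.sum_nbij' (· + k) (· + k) ?_ ?_ ?_ ?_ ?_
      · exact fun h hh => add_mem_rad hh hk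
      · exact fun h hh => add_mem_rad hh hk
      · intro h _
        simp [add_assoc, CharTwo.add_self_eq_zero]
      · intro h _
        simp [add_assoc, CharTwo.add_self_eq_zero]
      · intro h hh
        have hk0 : radPoly (D.π z.2.1) z.2.2 k = 0 := mem_rad.mp hk
        have h2 : D.inner z k * D.inner z k = 1 := by
          have := D.inner_add z k k
          rw [CharTwo.add_self_eq_zero, inner_zero, hk0] at this
          simpa using this.symm
        have h3 := D.inner_add z h k
        rw [hk0, mul_zero, AddChar.map_zero_eq_one, mul_one] at h3
        linear_combination (-D.inner z k) * h3 - D.inner z h * h2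
    rw [← Finset.sum_mul] at h1
    have h2 : (∑ h ∈ rad (D.π z.2.1) z.2.2, D.inner z h) * (D.inner z k - 1) = 0 := by
      linear_combination -h1
    exact (mul_eq_zero.mp h2).resolve_right (sub_ne_zero.mpr hk1)

lemma sq_add_sq_of_card_rad {z : ZMod 4 × R × F} (h : (rad (D.π z.2.1) z.2.2).card = 1) :
    D.re z ^ 2 + D.im z ^ 2 = Fintype.card F := by
  obtain ⟨x, hx⟩ := Finset.card_eq_one.mp h
  have h0 := zero_mem_rad (D.π z.2.1) z.2.2
  rw [hx, Finset.mem_singleton] at h0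
  have h1 := D.sq_add_sq z
  rw [hx, ← h0, Finset.sum_singleton, inner_zero, mul_one] at h1
  exact_mod_cast h1

lemma sq_add_sq_cases (z : ZMod 4 × R × F) : D.re z ^ 2 + D.im z ^ 2 = 0 ∨
    D.re z ^ 2 + D.im z ^ 2 = Fintype.card F * (rad (D.π z.2.1) z.2.2).card := by
  have h := D.sq_add_sq z
  rcases D.sum_inner_rad z with h1 | h1
  · left
    rw [h1, mul_zero] at h
    exact_mod_cast h
  · right
    rw [h1] at h
    exact_mod_cast h

variable {n : ℕ} (hF : Fintype.card F = 2 * 4 ^ n)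
include hF

lemma re_sq_of_right_zero {z : ZMod 4 × R × F} (ha : D.π z.2.1 ≠ 0) (hb : z.2.2 = 0) :
    D.re z ^ 2 = 4 ^ n := by
  apply sq_eq_of_sq_add_sq_eq_two_mul (y := D.im z)
  rw [D.sq_add_sq_of_card_rad (by rw [hb, rad_right_zero ha, Finset.card_singleton]), hF]
  push_cast
  rfl

lemma re_sq_of_rootless {z : ZMod 4 × R × F} (h : cubicRoots (D.π z.2.1) z.2.2 = ∅) :
    D.re z ^ 2 = 4 ^ n := by
  have hb : z.2.2 ≠ 0 := by
    intro hb
    rw [hb, TraceChar.cubicRoots_zero] at h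
    simp at h
  apply sq_eq_of_sq_add_sq_eq_two_mul (y := D.im z)
  rw [D.sq_add_sq_of_card_rad (by rw [card_rad _ hb, h, Finset.card_empty]), hF]
  push_cast
  rfl

lemma re_of_roots (hcube : ∀ x : F, ∃ y, y ^ 3 = x) {z : ZMod 4 × R × F} (hb : z.2.2 ≠ 0)
    (h : cubicRoots (D.π z.2.1) z.2.2 ≠ ∅) : D.re z = 0 ∨ D.re z ^ 2 = 4 ^ (n + 1) := by
  rcases D.sq_add_sq_cases z with h0 | h0
  · left
    nlinarith [sq_nonneg (D.re z), sq_nonneg (D.im z)]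
  · rw [card_rad _ hb, hF] at h0
    rcases D.t.cubic_trichotomy hcube (D.π z.2.1) hb with ⟨h1, -, -⟩ | ⟨h1, -, -⟩ | ⟨h1, -, -⟩
    · exact absurd h1 h
    · rw [h1] at h0
      rcases sq_eq_of_sq_add_sq_eq (n + 1) (h0.trans (by push_cast; ring)) with ⟨h2, -⟩ | ⟨h2, -⟩
      · exact Or.inl h2
      · exact Or.inr h2
    · rw [h1] at h0
      exact Or.inr (sq_eq_of_sq_add_sq_eq_two_mul (n + 1) (h0.trans (by push_cast; ring)))

omit hF [CharP F 2] in
lemma re_of_two_mul (u : ZMod 4) (w : R) :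
    D.re (u, 2 * w, 0) = if 2 * w = 0 then rePow u * Fintype.card F else 0 := by
  have h : ∑ x, D.pairing.e (u, 2 * w, 0) (D.pt x) =
      iPow u * if 2 * w = 0 then (Fintype.card F : ℂ) else 0 := by
    simp only [pairing_pt_eq_inner, inner, mul_assoc, ψ_two_mul, map_mul, D.π_τ, zero_mul,
      AddChar.map_zero_eq_one, mul_one, ← Finset.mul_sum, D.two_mul_eq_zero_iff]
    have := AddChar.sum_mulShift (D.π w) D.t.isPrimitive
    simp only [mul_comm _ (D.π w)] at this
    rw [this]
    norm_cast
  rw [sum_pairing_pt, iPow_eq] at h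
  have h1 := congrArg Complex.re h
  split_ifs at h1 ⊢ <;> simp at h1 <;> exact_mod_cast h1

/-- The four types of codewords, and the values the exponential sum takes on them. -/
lemma re_cases (hcube : ∀ x : F, ∃ y, y ^ 3 = x) (z : ZMod 4 × R × F) :
    (z.2.2 = 0 ∧ D.π z.2.1 = 0 ∧
      ((z.2.1 = 0 ∧ (z.1 = 0 ∨ z.1 = 2) ∧ (D.re z = 2 * 4 ^ n ∨ D.re z = -(2 * 4 ^ n))) ∨
      (¬ (z.2.1 = 0 ∧ (z.1 = 0 ∨ z.1 = 2)) ∧ D.re z = 0))) ∨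
    (z.2.2 = 0 ∧ D.π z.2.1 ≠ 0 ∧ (D.re z = 2 ^ n ∨ D.re z = -2 ^ n)) ∨
    (z.2.2 ≠ 0 ∧ cubicRoots (D.π z.2.1) z.2.2 = ∅ ∧ (D.re z = 2 ^ n ∨ D.re z = -2 ^ n)) ∨
    (z.2.2 ≠ 0 ∧ cubicRoots (D.π z.2.1) z.2.2 ≠ ∅ ∧
      (D.re z = 0 ∨ D.re z = 2 * 2 ^ n ∨ D.re z = -(2 * 2 ^ n))) := by
  by_cases hb : z.2.2 = 0
  · by_cases ha : D.π z.2.1 = 0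
    · refine Or.inl ⟨hb, ha, ?_⟩
      obtain ⟨u, a, b⟩ := z
      obtain ⟨w, rfl⟩ := D.ker a ha
      obtain rfl : b = 0 := hb
      have h := D.re_of_two_mul u w
      by_cases hw : 2 * w = 0
      · rw [if_pos hw, hF] at h
        have hu : ((u = 0 ∨ u = 2) ∧ (rePow u = 1 ∨ rePow u = -1)) ∨
            (¬ (u = 0 ∨ u = 2) ∧ rePow u = 0) := by
          clear h ha
          revert u
          decide
        rcases hu with ⟨hu, h1 | h1⟩ | ⟨hu, h1⟩
        · exact Or.inl ⟨hw, hu, Or.inl (by rw [h, h1]; push_cast; ring)⟩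
        · exact Or.inl ⟨hw, hu, Or.inr (by rw [h, h1]; push_cast; ring)⟩
        · exact Or.inr ⟨fun h => hu h.2, by rw [h, h1, zero_mul]⟩
      · rw [if_neg hw] at h
        exact Or.inr ⟨fun h => hw h.1, h⟩
    · exact Or.inr (Or.inl ⟨hb, ha, eq_or_eq_neg_two_pow (D.re_sq_of_right_zero hF ha hb)⟩)
  · by_cases hr : cubicRoots (D.π z.2.1) z.2.2 = ∅
    · exact Or.inr (Or.inr (Or.inl ⟨hb, hr, eq_or_eq_neg_two_pow (D.re_sq_of_rootless hF hr)⟩))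
    · refine Or.inr (Or.inr (Or.inr ⟨hb, hr, ?_⟩))
      rcases D.re_of_roots hF hcube hb hr with h | h
      · exact Or.inl h
      · rw [← pow_succ']
        exact Or.inr (eq_or_eq_neg_two_pow h)

omit hF in
lemma two_pow_bounds (hn : n ≠ 0) : (2 : ℤ) ≤ 2 ^ n ∧ (2 : ℤ) * 2 ^ n < 2 * 4 ^ n := by
  have h1 : (2 : ℤ) ^ 1 ≤ 2 ^ n := pow_le_pow_right₀ (by norm_num) (by omega)
  have h2 : (4 : ℤ) ^ n = 2 ^ n * 2 ^ n := by rw [← mul_pow]; norm_num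
  constructor
  · linarith
  · nlinarith


/-- The conditions defining the ten classes, in terms of the value `r` of the real part of the
exponential sum and of the membership `k` in the Kerdock code. -/
def classSpec (n : ℕ) (r : ℤ) (k : Prop) : Fin 10 → Prop :=
  ![r = 2 * 4 ^ n, r = 2 * 2 ^ n, r = 2 ^ n ∧ k, r = 2 ^ n ∧ ¬ k, r = 0 ∧ k, r = 0 ∧ ¬ k,
    r = -2 ^ n ∧ ¬ k, r = -2 ^ n ∧ k, r = -(2 * 2 ^ n), r = -(2 * 4 ^ n)]

omit hF in
lemma classSpec_unique (hn : n ≠ 0) {r : ℤ} {k : Prop} {i j : Fin 10} (hi : classSpec n r k i)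
    (hj : classSpec n r k j) : i = j := by
  obtain ⟨h1, h2⟩ := two_pow_bounds hn
  simp only [classSpec] at hi hj
  generalize (2 : ℤ) ^ n = s at *
  generalize (2 : ℤ) * 4 ^ n = q at *
  fin_cases i <;> fin_cases j <;> first
    | rfl
    | (exfalso; simp at hi hj; first | omega | exact hj.2 hi.2 | exact hi.2 hj.2)

lemma exists_classSpec (hcube : ∀ x : F, ∃ y, y ^ 3 = x) (z : ZMod 4 × R × F) :
    ∃ i, classSpec n (D.re z) (z.2.2 = 0) i := by
  rcases D.re_cases hF hcube z with ⟨hb, -, ⟨-, -, h | h⟩ | ⟨-, h⟩⟩ | ⟨hb, -, h | h⟩ |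
    ⟨hb, -, h | h⟩ | ⟨hb, -, h | h | h⟩
  · exact ⟨0, h⟩
  · exact ⟨9, h⟩
  · exact ⟨4, h, hb⟩
  · exact ⟨2, h, hb⟩
  · exact ⟨7, h, hb⟩
  · exact ⟨3, h, hb⟩
  · exact ⟨6, h, hb⟩
  · exact ⟨5, h, hb⟩
  · exact ⟨1, h⟩
  · exact ⟨8, h⟩

/-- The index of the class of a codeword. -/
noncomputable def cls (n : ℕ) (z : ZMod 4 × R × F) : Fin 10 :=
  Classical.epsilon (classSpec n (D.re z) (z.2.2 = 0))

lemma cls_eq_iff (hn : n ≠ 0) (hcube : ∀ x : F, ∃ y, y ^ 3 = x) (z : ZMod 4 × R × F)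
    (i : Fin 10) : D.cls n z = i ↔ classSpec n (D.re z) (z.2.2 = 0) i := by
  have h : classSpec n (D.re z) (z.2.2 = 0) (D.cls n z) :=
    Classical.epsilon_spec (D.exists_classSpec hF hcube z)
  exact ⟨fun hi => hi ▸ h, fun hi => classSpec_unique hn h hi⟩

omit hF in
lemma exists_unit_rootless : ∃ b : F, cubicRoots 1 b = ∅ := by
  by_contra! h
  have hsurj : Function.Surjective fun w : F => w ^ 3 + w := by
    intro b
    obtain ⟨w, hw⟩ := h b
    rw [mem_cubicRoots] at hw
    exact ⟨w, by simpa using hw⟩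
  refine zero_ne_one ((Finite.injective_iff_surjective.mpr hsurj) ?_ : (0 : F) = 1)
  simp [CharTwo.add_self_eq_zero]

omit [Fintype R] [CharP F 2] hF in
lemma exists_re_eq (a : R) (b : F) (x : ℤ) (hx : ∃ u, D.re (u, a, b) = x ∨ D.re (u, a, b) = -x) :
    (∃ u, D.re (u, a, b) = x) ∧ ∃ u, D.re (u, a, b) = -x := by
  obtain ⟨u, h⟩ := hx
  have h2 := D.re_two_add (u, a, b)
  rcases h with h | h
  · exact ⟨⟨u, h⟩, ⟨_, h2.trans (by rw [h])⟩⟩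
  · exact ⟨⟨_, h2.trans (by rw [h, neg_neg])⟩, ⟨u, h⟩⟩

lemma exists_re_eq_two_mul (hcube : ∀ x : F, ∃ y, y ^ 3 = x) : ∃ a : R, (∃ u, D.re (u, a, 1) = 0) ∧
    ∃ u, D.re (u, a, 1) = 2 * 2 ^ n ∨ D.re (u, a, 1) = -(2 * 2 ^ n) := by
  refine ⟨2, ?_⟩
  have ha : D.π 2 = 0 := by simpa using D.π_two_mul 1
  have hrad : rad (0 : F) 1 = {0, 1} := by
    have hinj : Function.Injective fun x : F => x ^ 3 := Finite.injective_iff_surjective.mpr hcube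
    ext h
    have h3 : h ^ 3 = 1 ↔ h = 1 := by
      rw [← hinj.eq_iff (a := h), one_pow]
    have h4 : radPoly 0 1 h = h * (h ^ 3 - 1) := by
      rw [radPoly]
      linear_combination h * CharTwo.two_eq_zero (R := F)
    rw [mem_rad, h4, mul_eq_zero, sub_eq_zero, h3, Finset.mem_insert, Finset.mem_singleton]
  have h1 : D.inner (0, 2, 1) 1 = 1 := by
    simp only [inner, ψ_two_mul, D.π_τ, one_pow, one_mul, D.t.mul_self_eq_one]
  have h2 := D.sq_add_sq (0, 2, 1)
  simp only [ha, hrad] at h2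
  rw [Finset.sum_pair zero_ne_one, inner_zero, h1, hF] at h2
  have h3 : D.re (0, 2, 1) ^ 2 + D.im (0, 2, 1) ^ 2 = 4 ^ (n + 1) := by
    have : ((D.re (0, 2, 1) ^ 2 + D.im (0, 2, 1) ^ 2 : ℤ) : ℂ) = ((4 ^ (n + 1) : ℤ) : ℂ) := by
      rw [h2]
      push_cast
      ring
    exact_mod_cast this
  have h4 := D.re_one_add (0, 2, 1)
  rcases sq_eq_of_sq_add_sq_eq (n + 1) h3 with ⟨h5, h6⟩ | ⟨h5, h6⟩
  · refine ⟨⟨_, h5⟩, 1 + 0, ?_⟩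
    rw [h4, neg_eq_iff_eq_neg, neg_inj, ← pow_succ', or_comm]
    exact eq_or_eq_neg_two_pow h6
  · refine ⟨⟨_, h4.trans (by rw [h6, neg_zero])⟩, 0, ?_⟩
    rw [← pow_succ']
    exact eq_or_eq_neg_two_pow h5

lemma cls_surjective (hn : n ≠ 0) (hcube : ∀ x : F, ∃ y, y ^ 3 = x) :
    Function.Surjective (D.cls n) := by
  have key : ∀ i : Fin 10, (∃ z, classSpec n (D.re z) (z.2.2 = 0) i) → ∃ z, D.cls n z = i := by
    rintro i ⟨z, hz⟩
    exact ⟨z, (D.cls_eq_iff hF hn hcube z i).mpr hz⟩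
  have h0 : ∀ u, D.re (u, 0, 0) = rePow u * (2 * 4 ^ n) := by
    intro u
    have := D.re_of_two_mul u 0
    rw [mul_zero, if_pos rfl, hF] at this
    exact_mod_cast this
  obtain ⟨b, hb⟩ := exists_unit_rootless (F := F)
  have hb0 : b ≠ 0 := by
    rintro rfl
    simp [TraceChar.cubicRoots_zero] at hb
  obtain ⟨⟨u2, h2⟩, ⟨u7, h7⟩⟩ := D.exists_re_eq 1 0 (2 ^ n)
    ⟨0, eq_or_eq_neg_two_pow (D.re_sq_of_right_zero hF (by simp) rfl)⟩
  obtain ⟨⟨u3, h3⟩, ⟨u6, h6⟩⟩ := D.exists_re_eq 1 b (2 ^ n)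
    ⟨0, eq_or_eq_neg_two_pow (D.re_sq_of_rootless hF (by simpa using hb))⟩
  obtain ⟨a, ⟨u5, h5⟩, hu⟩ := D.exists_re_eq_two_mul hF hcube
  obtain ⟨⟨u1, h1⟩, ⟨u8, h8⟩⟩ := D.exists_re_eq a 1 (2 * 2 ^ n) hu
  intro i
  apply key
  fin_cases i
  · exact ⟨(0, 0, 0), (h0 0).trans (one_mul _)⟩
  · exact ⟨_, h1⟩
  · exact ⟨_, h2, rfl⟩
  · exact ⟨_, h3, hb0⟩
  · exact ⟨(1, 0, 0), (h0 1).trans (zero_mul _), rfl⟩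
  · exact ⟨_, h5, one_ne_zero⟩
  · exact ⟨_, h6, hb0⟩
  · exact ⟨_, h7, rfl⟩
  · exact ⟨_, h8⟩
  · exact ⟨(2, 0, 0), (h0 2).trans (neg_one_mul _)⟩

end GaloisData

end Values

section Blocks

namespace GaloisData

variable {R F : Type*} [CommRing R] [Fintype R] [Field F] [Fintype F] [CharP F 2]
  (D : GaloisData R F)

/-- The residue of `w` when the argument is `2 * w`. -/
noncomputable def half (A : R) : F := if h : ∃ w, A = 2 * w then D.π h.choose else 0

omit [Fintype F] [CharP F 2] in
lemma half_two_mul (w : R) : D.half (2 * w) = D.π w := by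
  have h : ∃ v, 2 * w = 2 * v := ⟨w, rfl⟩
  rw [half, dif_pos h]
  exact ((D.two_mul_eq_iff _ _).mp h.choose_spec).symm

/-- Functions of the residue of the linear coefficient and of the cubic coefficient. -/
def plane (φ : F → F → ℂ) (z : ZMod 4 × R × F) : ℂ := φ (D.π z.2.1) z.2.2

/-- The annihilator of the subgroup on which the residue of the linear coefficient and the cubic
coefficient vanish. -/
def OnPlane (g : ZMod 4 × R × F) : Prop := g.1 = 0 ∧ D.π g.2.1 = 0

omit [CharP F 2] in
lemma sum_comp_π (f : F → ℂ) :
    ∑ a, f (D.π a) = (Finset.univ.filter fun a => D.π a = 0).card * ∑ x, f x := by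
  have h : ∀ x, (Finset.univ.filter fun a => D.π a = x).card =
      (Finset.univ.filter fun a => D.π a = 0).card := by
    intro x
    refine Finset.card_bij' (fun a _ => a - D.τ x) (fun a _ => a + D.τ x) ?_ ?_ ?_ ?_ <;>
      simp +contextual [D.π_τ]
  rw [← Finset.sum_fiberwise (s := Finset.univ) (g := D.π), Finset.mul_sum]
  refine Finset.sum_congr rfl fun x _ => ?_
  rw [← h x, ← nsmul_eq_mul]
  exact Finset.sum_eq_card_nsmul fun a ha => by rw [(Finset.mem_filter.mp ha).2]

omit [CharP F 2] in
lemma ft_plane_of_onPlane (φ : F → F → ℂ) {g : ZMod 4 × R × F} (hg : D.OnPlane g) :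
    D.pairing.ft (D.plane φ) g = 4 * (Finset.univ.filter fun a => D.π a = 0).card *
      D.t.hat φ (D.half g.2.1) g.2.2 := by
  obtain ⟨s, A, B⟩ := g
  obtain ⟨rfl, hA⟩ := hg
  obtain ⟨w, rfl⟩ := D.ker A hA
  have h1 : ∀ a : R, D.ψ (a * (2 * w)) = D.t.χ (D.π a * D.π w) := by
    intro a
    rw [← map_mul, ← ψ_two_mul]
    congr 1
    ring
  simp only [SelfPairing.ft, plane, pairing_apply, Fintype.sum_prod_type, mul_zero,
    AddChar.map_zero_eq_one, one_mul, h1, Finset.sum_const, half_two_mul, TraceChar.hat]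
  rw [D.sum_comp_π fun α => ∑ b, φ α b * (D.t.χ (α * D.π w) * D.t.χ (b * B))]
  simp [mul_assoc]

lemma ft_plane_of_not_onPlane (φ : F → F → ℂ) {g : ZMod 4 × R × F} (hg : ¬ D.OnPlane g) :
    D.pairing.ft (D.plane φ) g = 0 := by
  by_cases hs : g.1 = 0
  · have hA : D.π g.2.1 ≠ 0 := fun h => hg ⟨hs, h⟩
    have : ∃ x, D.t.χ (D.π g.2.1 * x) ≠ 1 := by
      by_contra! h
      exact hA (D.eq_zero_of_χ h)
    obtain ⟨x, hx⟩ := this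
    refine D.pairing.ft_eq_zero_of_invariant _ g (0, 2 * D.τ x, 0) (fun z => ?_) ?_
    · simp [plane, π_two_mul]
    · rw [pairing_apply, mul_assoc, ψ_two_mul, map_mul D.π, D.π_τ, mul_comm (x : F)]
      simpa using hx
  · refine D.pairing.ft_eq_zero_of_invariant _ g (1, 0, 0) (fun z => ?_) ?_
    · simp [plane]
    · simpa [pairing_apply] using iPow_ne_one hs

/-- The evaluation points together with their negatives. -/
def sgnPt (p : Bool × F) : ZMod 4 × R × F := if p.1 then D.pt p.2 else -D.pt p.2

omit [CharP F 2] in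
lemma two_mul_re (z : ZMod 4 × R × F) :
    2 * (D.re z : ℂ) = ∑ p, D.pairing.e z (-D.sgnPt p) := by
  simp only [Fintype.sum_prod_type, Fintype.sum_bool, sgnPt, if_true, Bool.false_eq_true, if_false,
    neg_neg]
  rw [sum_pairing_pt, sum_pairing_neg_pt]
  ring

omit [CharP F 2] in
lemma two_mul_ft_mul_re (φ : ZMod 4 × R × F → ℂ) (g : ZMod 4 × R × F) :
    2 * D.pairing.ft (fun z => φ z * D.re z) g = ∑ p, D.pairing.ft φ (g - D.sgnPt p) := by
  simp only [sub_eq_add_neg, SelfPairing.ft, SelfPairing.add_right]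
  rw [Finset.sum_comm, Finset.mul_sum]
  refine Finset.sum_congr rfl fun z _ => ?_
  simp only [← mul_assoc]
  rw [← Finset.mul_sum, ← two_mul_re]
  ring

/-- The representations of a point as the sum of two signed evaluation points. -/
noncomputable def reps (g : ZMod 4 × R × F) : Finset ((Bool × F) × (Bool × F)) :=
  Finset.univ.filter fun p => D.sgnPt p.1 + D.sgnPt p.2 = g

omit [Fintype R] [CharP F 2] in
lemma mem_reps {g : ZMod 4 × R × F} {p : (Bool × F) × (Bool × F)} :
    p ∈ D.reps g ↔ D.sgnPt p.1 + D.sgnPt p.2 = g := by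
  simp [reps]

omit [CharP F 2] in
lemma four_mul_ft_re_sq (g : ZMod 4 × R × F) :
    4 * D.pairing.ft (fun z => (D.re z : ℂ) ^ 2) g =
      Fintype.card (ZMod 4 × R × F) * (D.reps g).card := by
  have h1 : ∀ g, D.pairing.ft (fun _ => 1) g =
      if g = 0 then (Fintype.card (ZMod 4 × R × F) : ℂ) else 0 := by
    intro g
    have := D.pairing.sum_eq g
    simp only [D.pairing.comm g] at this
    simp only [SelfPairing.ft, one_mul, this]
    split_ifs <;> rfl
  have h2 := D.two_mul_ft_mul_re fun _ => 1
  have h3 := D.two_mul_ft_mul_re (fun z => 1 * D.re z) g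
  simp only [one_mul] at h2 h3
  calc 4 * D.pairing.ft (fun z => (D.re z : ℂ) ^ 2) g
      = ∑ p, 2 * D.pairing.ft (fun z => (D.re z : ℂ)) (g - D.sgnPt p) := by
        rw [← Finset.mul_sum, ← h3, ← mul_assoc]
        simp only [sq]
        norm_num
    _ = ∑ p : (Bool × F) × (Bool × F), if D.sgnPt p.1 + D.sgnPt p.2 = g then
          (Fintype.card (ZMod 4 × R × F) : ℂ) else 0 := by
        simp only [h2, h1, Fintype.sum_prod_type (α₁ := Bool × F), sub_sub, sub_eq_zero]
        simp only [eq_comm]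
    _ = _ := by
        rw [← Finset.sum_filter, Finset.sum_const, nsmul_eq_mul, mul_comm]
        rfl

/-- The block of the residue and cubic coordinates of a point of the annihilator. -/
noncomputable def shortBlock (g : ZMod 4 × R × F) : Fin 4 :=
  TraceChar.planeBlock (D.half g.2.1) g.2.2

/-- The translate of a point with odd first coordinate which lies in the annihilator. -/
noncomputable def shift (g : ZMod 4 × R × F) : ZMod 4 × R × F :=
  g - D.sgnPt (decide (g.1 = 1), D.π g.2.1)

/-- The partition of the dual group. -/
noncomputable def block (g : ZMod 4 × R × F) : Fin 4 ⊕ Bool ⊕ Fin 4 :=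
  if D.OnPlane g then Sum.inl (D.shortBlock g)
  else if g.1 = 0 ∨ g.1 = 2 then Sum.inr (Sum.inl (decide (D.reps g = ∅)))
  else Sum.inr (Sum.inr (D.shortBlock (D.shift g)))

omit [CharP F 2] in
lemma block_eq_iff (g g' : ZMod 4 × R × F) (h : D.block g = D.block g') :
    (D.OnPlane g ∧ D.OnPlane g' ∧ D.shortBlock g = D.shortBlock g') ∨
    (¬ D.OnPlane g ∧ ¬ D.OnPlane g' ∧ (g.1 = 0 ∨ g.1 = 2) ∧ (g'.1 = 0 ∨ g'.1 = 2) ∧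
      (D.reps g = ∅ ↔ D.reps g' = ∅)) ∨
    ((g.1 = 1 ∨ g.1 = 3) ∧ (g'.1 = 1 ∨ g'.1 = 3) ∧
      D.shortBlock (D.shift g) = D.shortBlock (D.shift g')) := by
  have hodd : ∀ s : ZMod 4, ¬ (s = 0 ∨ s = 2) → s = 1 ∨ s = 3 := by decide
  rw [block, block] at h
  split_ifs at h with h1 h2 h3 h4 h5 h6 h7 h8 <;>
    simp only [Sum.inl.injEq, Sum.inr.injEq, reduceCtorEq, decide_eq_decide] at h
  · exact Or.inl ⟨h1, h2, h⟩
  · exact Or.inr (Or.inl ⟨h1, h5, h4, h6, h⟩)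
  · exact Or.inr (Or.inr ⟨hodd _ h4, hodd _ h8, h⟩)

omit [Fintype R] [Fintype F] [CharP F 2] in
lemma sgnPt_fst (p : Bool × F) : (D.sgnPt p).1 = if p.1 then 1 else -1 := by
  rw [sgnPt]
  split_ifs <;> rfl

omit [Fintype R] [Fintype F] in
lemma π_sgnPt (p : Bool × F) : D.π (D.sgnPt p).2.1 = p.2 := by
  rw [sgnPt]
  split_ifs
  · exact D.π_τ _
  · simp [pt, D.π_τ, CharTwo.neg_eq]

omit [Fintype R] [Fintype F] in
lemma onPlane_sub_sgnPt {g : ZMod 4 × R × F} {p : Bool × F} :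
    D.OnPlane (g - D.sgnPt p) ↔ g.1 = (if p.1 then 1 else -1) ∧ D.π g.2.1 = p.2 := by
  simp only [OnPlane, Prod.fst_sub, Prod.snd_sub, map_sub, sgnPt_fst, π_sgnPt, sub_eq_zero]

omit [Fintype R] [Fintype F] in
lemma onPlane_shift {g : ZMod 4 × R × F} (h : g.1 = 1 ∨ g.1 = 3) : D.OnPlane (D.shift g) := by
  rw [shift, onPlane_sub_sgnPt]
  refine ⟨?_, rfl⟩
  have h31 : (3 : ZMod 4) ≠ 1 := by decide
  rcases h with h | h
  · simp [h]
  · simp only [h, h31, decide_false, Bool.false_eq_true, if_false]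
    decide

lemma two_mul_ft_plane_mul_re_of_odd (φ : F → F → ℂ) (g : ZMod 4 × R × F) :
    2 * D.pairing.ft (fun z => D.plane φ z * D.re z) g =
      D.pairing.ft (D.plane φ) (D.shift g) := by
  rw [two_mul_ft_mul_re, shift]
  refine Finset.sum_eq_single (decide (g.1 = 1), D.π g.2.1) (fun p _ hp => ?_) (by simp)
  refine D.ft_plane_of_not_onPlane φ fun hon => hp ?_
  rw [onPlane_sub_sgnPt] at hon
  refine Prod.ext ?_ hon.2.symm
  simp only [hon.1]
  generalize p.1 = b
  revert b
  decide

lemma ft_plane_mul_re_of_even (φ : F → F → ℂ) {g : ZMod 4 × R × F} (h : g.1 = 0 ∨ g.1 = 2) :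
    D.pairing.ft (fun z => D.plane φ z * D.re z) g = 0 := by
  have h1 : 2 * D.pairing.ft (fun z => D.plane φ z * D.re z) g = 0 := by
    rw [two_mul_ft_mul_re]
    refine Finset.sum_eq_zero fun p _ => D.ft_plane_of_not_onPlane φ fun hon => ?_
    rw [onPlane_sub_sgnPt] at hon
    rw [hon.1] at h
    generalize p.1 = b at h
    revert b
    decide
  exact (mul_eq_zero.mp h1).resolve_left two_ne_zero

section Membership

variable {φ : F → F → ℂ} (hφ : ∀ x y x' y', TraceChar.planeBlock x y = TraceChar.planeBlock x' y' →
  D.t.hat φ x y = D.t.hat φ x' y')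
include hφ

omit [CharP F 2] in
lemma ft_plane_congr {g g' : ZMod 4 × R × F} (hg : D.OnPlane g) (hg' : D.OnPlane g')
    (h : D.shortBlock g = D.shortBlock g') :
    D.pairing.ft (D.plane φ) g = D.pairing.ft (D.plane φ) g' := by
  rw [D.ft_plane_of_onPlane φ hg, D.ft_plane_of_onPlane φ hg', hφ _ _ _ _ h]

lemma plane_mem : D.plane φ ∈ D.pairing.fibreConst D.block := by
  intro g g' h
  rcases D.block_eq_iff g g' h with ⟨h1, h2, h3⟩ | ⟨h1, h2, -⟩ | ⟨h1, h2, -⟩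
  · exact D.ft_plane_congr hφ h1 h2 h3
  · rw [D.ft_plane_of_not_onPlane φ h1, D.ft_plane_of_not_onPlane φ h2]
  · have hne : ∀ s : ZMod 4, s = 1 ∨ s = 3 → s ≠ 0 := by decide
    rw [D.ft_plane_of_not_onPlane φ fun h => hne _ h1 h.1,
      D.ft_plane_of_not_onPlane φ fun h => hne _ h2 h.1]

lemma plane_mul_re_mem :
    (fun z => D.plane φ z * D.re z) ∈ D.pairing.fibreConst D.block := by
  intro g g' h
  rcases D.block_eq_iff g g' h with ⟨h1, h2, -⟩ | ⟨-, -, h1, h2, -⟩ | ⟨h1, h2, h3⟩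
  · rw [D.ft_plane_mul_re_of_even φ (Or.inl h1.1), D.ft_plane_mul_re_of_even φ (Or.inl h2.1)]
  · rw [D.ft_plane_mul_re_of_even φ h1, D.ft_plane_mul_re_of_even φ h2]
  · apply mul_left_cancel₀ (two_ne_zero (α := ℂ))
    rw [D.two_mul_ft_plane_mul_re_of_odd φ g, D.two_mul_ft_plane_mul_re_of_odd φ g']
    exact D.ft_plane_congr hφ (D.onPlane_shift h1) (D.onPlane_shift h2) h3

end Membership

/-- The indicator of the subgroup generated by the constant word `2`. -/
noncomputable def evenConst (z : ZMod 4 × R × F) : ℂ :=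
  if z.2.1 = 0 ∧ z.2.2 = 0 ∧ (z.1 = 0 ∨ z.1 = 2) then 1 else 0

omit [CharP F 2] in
lemma ft_evenConst (g : ZMod 4 × R × F) : D.pairing.ft evenConst g = 1 + iPow (2 * g.1) := by
  have h : (Finset.univ.filter fun z : ZMod 4 × R × F =>
      z.2.1 = 0 ∧ z.2.2 = 0 ∧ (z.1 = 0 ∨ z.1 = 2)) = {(0, 0, 0), (2, 0, 0)} := by
    ext ⟨u, a, b⟩
    simp only [Finset.mem_filter, Finset.mem_univ, true_and, Finset.mem_insert,
      Finset.mem_singleton, Prod.mk.injEq]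
    tauto
  simp only [SelfPairing.ft, evenConst, ite_mul, one_mul, zero_mul]
  rw [← Finset.sum_filter, h, Finset.sum_pair]
  · simp [pairing_apply]
  · simp only [ne_eq, Prod.mk.injEq, and_true]
    decide

omit [CharP F 2] in
lemma evenConst_mem : evenConst ∈ D.pairing.fibreConst D.block := by
  have heven : ∀ s s' : ZMod 4, (s = 0 ∨ s = 2) → (s' = 0 ∨ s' = 2) → 2 * s = 2 * s' := by decide
  have hodd : ∀ s s' : ZMod 4, (s = 1 ∨ s = 3) → (s' = 1 ∨ s' = 3) → 2 * s = 2 * s' := by decide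
  intro g g' h
  rw [ft_evenConst, ft_evenConst]
  rcases D.block_eq_iff g g' h with ⟨h1, h2, -⟩ | ⟨-, -, h1, h2, -⟩ | ⟨h1, h2, -⟩
  · rw [h1.1, h2.1]
  · rw [heven _ _ h1 h2]
  · rw [hodd _ _ h1 h2]

omit [Fintype R] in
lemma sum_prod_eq_of_τ {x y x' y' : F} (h : D.τ x + D.τ y = D.τ x' + D.τ y') :
    (x = x' ∧ y = y') ∨ (x = y' ∧ y = x') := by
  have hs : x + y = x' + y' := by
    have := congrArg D.π h
    simpa only [map_add, D.π_τ] using this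
  have hp : x * y = x' * y' := by
    obtain ⟨x, rfl⟩ := (bijective_sq (F := F)).2 x
    obtain ⟨y, rfl⟩ := (bijective_sq (F := F)).2 y
    obtain ⟨x', rfl⟩ := (bijective_sq (F := F)).2 x'
    obtain ⟨y', rfl⟩ := (bijective_sq (F := F)).2 y'
    simp only at h hs ⊢
    have h1 := D.τ_add_of_sq x y
    rw [hs, D.τ_add_of_sq, h, add_right_inj, D.two_mul_eq_iff, map_mul, map_mul] at h1
    simp only [D.π_τ] at h1
    rw [← mul_pow, ← mul_pow, h1]
  have : (x - x') * (x - y') = 0 := by linear_combination x * hs - hp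
  rcases mul_eq_zero.mp this with h1 | h1
  · left
    rw [sub_eq_zero] at h1
    subst h1
    exact ⟨rfl, add_left_cancel hs⟩
  · right
    rw [sub_eq_zero] at h1
    subst h1
    exact ⟨rfl, by linear_combination hs⟩

omit [Fintype R] in
lemma eq_of_τ_sum_eq_zero {x y x' y' : F} (h : D.τ x + D.τ y + (D.τ x' + D.τ y') = 0)
    (hc : x ^ 3 + y ^ 3 = x' ^ 3 + y' ^ 3) : x = y ∧ x = x' ∧ x = y' := by
  have hs : x + y = x' + y' := by
    have := congrArg D.π h
    simp only [map_add, D.π_τ, map_zero] at this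
    linear_combination this - (x' + y') * CharTwo.two_eq_zero (R := F)
  have hp : (x + y) ^ 2 = x * y + x' * y' := by
    obtain ⟨x, rfl⟩ := (bijective_sq (F := F)).2 x
    obtain ⟨y, rfl⟩ := (bijective_sq (F := F)).2 y
    obtain ⟨x', rfl⟩ := (bijective_sq (F := F)).2 x'
    obtain ⟨y', rfl⟩ := (bijective_sq (F := F)).2 y'
    simp only at h hs ⊢
    have h1 : 2 * D.τ (x ^ 2 + y ^ 2) = 2 * (D.τ x * D.τ y + D.τ x' * D.τ y') := by
      have h1 := D.τ_add_of_sq x y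
      have h2 := D.τ_add_of_sq x' y'
      rw [← hs] at h2
      linear_combination h1 + h2 + h
    rw [D.two_mul_eq_iff] at h1
    simp only [map_add, map_mul, D.π_τ] at h1
    rw [h1, CharTwo.add_sq, mul_pow, mul_pow]
  obtain rfl : y' = x + y - x' := by linear_combination -hs
  have hd : (x + y) ^ 3 = 0 := by
    linear_combination (x + y) * hp + hc + (2 * (x + y) * (x * y) - (x + y) * (x' * (x + y - x'))) *
      CharTwo.two_eq_zero (R := F)
  have hxy : x + y = 0 := pow_eq_zero_iff three_ne_zero |>.mp hd
  obtain rfl : x = y := CharTwo.add_eq_zero.mp hxy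
  rw [hxy, zero_sub, CharTwo.neg_eq, zero_pow two_ne_zero] at hp
  rw [hxy, zero_sub, CharTwo.neg_eq]
  have h1 : x ^ 2 = x' ^ 2 := by
    linear_combination -hp - x' ^ 2 * CharTwo.two_eq_zero (R := F)
  have h2 := (bijective_sq (F := F)).1 h1
  exact ⟨rfl, h2, h2⟩

omit [Fintype R] [Fintype F] [CharP F 2] in
lemma sgnPt_snd_fst (p : Bool × F) :
    (D.sgnPt p).2.1 = if p.1 then D.τ p.2 else -D.τ p.2 := by
  rw [sgnPt]
  split_ifs <;> rfl

omit [Fintype R] [Fintype F] in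
lemma sgnPt_snd_snd (p : Bool × F) : (D.sgnPt p).2.2 = p.2 ^ 3 := by
  rw [sgnPt]
  split_ifs
  · rfl
  · exact CharTwo.neg_eq _

omit [Fintype R] [Fintype F] [CharP F 2] in
lemma sgnPt_not (p : Bool × F) : D.sgnPt (!p.1, p.2) = -D.sgnPt p := by
  obtain ⟨b, x⟩ := p
  cases b <;> simp [sgnPt]

omit [Fintype R] in
lemma sgnPt_add_eq {p p' r r' : Bool × F} (hp : ¬ D.OnPlane (D.sgnPt p + D.sgnPt p'))
    (h : D.sgnPt p + D.sgnPt p' = D.sgnPt r + D.sgnPt r') :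
    (r = p ∧ r' = p') ∨ (r = p' ∧ r' = p) ∨ (p = p' ∧ r = r' ∧ r = (!p.1, p.2)) := by
  have h1 := congrArg (fun g => g.1) h
  have h2 := congrArg (fun g => g.2.1) h
  have h3 := congrArg (fun g => g.2.2) h
  simp only [OnPlane, Prod.fst_add, Prod.snd_add, map_add, sgnPt_fst, sgnPt_snd_fst,
    sgnPt_snd_snd] at hp h1 h2 h3
  obtain ⟨b, x⟩ := p
  obtain ⟨b', x'⟩ := p'
  obtain ⟨c, y⟩ := r
  obtain ⟨c', y'⟩ := r'
  have hsigns : (b = c ∧ b' = c') ∨ (b = c' ∧ b' = c ∧ b' = !b) ∨ (b = b' ∧ c = c' ∧ c = !b) := by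
    have key : ∀ b b' c c' : Bool, (if b then (1 : ZMod 4) else 3) + (if b' then 1 else 3) =
        (if c then 1 else 3) + (if c' then 1 else 3) →
        (b = c ∧ b' = c') ∨ (b = c' ∧ b' = c ∧ b' = !b) ∨ (b = b' ∧ c = c' ∧ c = !b) := by
      decide
    exact key b b' c c' h1
  have hne : b' = (!b) → x ≠ x' := by
    rintro rfl rfl
    apply hp
    cases b <;> simp [D.π_τ]
  clear hp h1
  simp only at h2 h3
  rcases hsigns with ⟨rfl, rfl⟩ | ⟨rfl, rfl, rfl⟩ | ⟨rfl, rfl, rfl⟩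
  · have key : (x = y ∧ x' = y') ∨ (b' = b ∧ x = y' ∧ x' = y) := by
      cases b <;> cases b' <;> simp only [if_true, if_false, Bool.false_eq_true] at h2
      · rcases D.sum_prod_eq_of_τ (x := x) (y := x') (x' := y) (y' := y')
          (by linear_combination -h2) with h | h
        · exact Or.inl h
        · exact Or.inr ⟨rfl, h⟩
      · rcases D.sum_prod_eq_of_τ (x := x) (y := y') (x' := y) (y' := x')
          (by linear_combination -h2) with h | h
        · exact Or.inl ⟨h.1, h.2.symm⟩
        · exact absurd h.1 (hne rfl)
      · rcases D.sum_prod_eq_of_τ (x := x) (y := y') (x' := y) (y' := x')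
          (by linear_combination h2) with h | h
        · exact Or.inl ⟨h.1, h.2.symm⟩
        · exact absurd h.1 (hne rfl)
      · rcases D.sum_prod_eq_of_τ h2 with h | h
        · exact Or.inl h
        · exact Or.inr ⟨rfl, h⟩
    rcases key with ⟨rfl, rfl⟩ | ⟨rfl, rfl, rfl⟩
    · exact Or.inl ⟨rfl, rfl⟩
    · exact Or.inr (Or.inl ⟨rfl, rfl⟩)
  · have key : x = y' ∧ x' = y := by
      cases b <;> simp only [if_true, if_false, Bool.false_eq_true, Bool.not_false,
        Bool.not_true] at h2
      · rcases D.sum_prod_eq_of_τ (x := x) (y := y) (x' := y') (y' := x')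
          (by linear_combination -h2) with h | h
        · exact ⟨h.1, h.2.symm⟩
        · exact absurd h.1 (hne rfl)
      · rcases D.sum_prod_eq_of_τ (x := x) (y := y) (x' := y') (y' := x')
          (by linear_combination h2) with h | h
        · exact ⟨h.1, h.2.symm⟩
        · exact absurd h.1 (hne rfl)
    obtain ⟨rfl, rfl⟩ := key
    exact Or.inr (Or.inl ⟨rfl, rfl⟩)
  · have h0 : D.τ x + D.τ x' + (D.τ y + D.τ y') = 0 := by
      cases b <;> simp only [if_true, if_false, Bool.false_eq_true, Bool.not_false,
        Bool.not_true] at h2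
      · linear_combination -h2
      · linear_combination h2
    obtain ⟨rfl, rfl, rfl⟩ := D.eq_of_τ_sum_eq_zero h0 h3
    exact Or.inr (Or.inr ⟨rfl, rfl, rfl⟩)

omit [Fintype R] in
lemma card_reps_of_nonempty {g : ZMod 4 × R × F} (hg : ¬ D.OnPlane g) (h : D.reps g ≠ ∅) :
    (D.reps g).card = 2 := by
  obtain ⟨⟨p, p'⟩, hp⟩ := Finset.nonempty_iff_ne_empty.mpr h
  rw [mem_reps] at hp
  subst hp
  simp only at hg ⊢
  by_cases hpp : p = p'
  · subst hpp
    have h2 : D.reps (D.sgnPt p + D.sgnPt p) = {(p, p), ((!p.1, p.2), (!p.1, p.2))} := by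
      ext ⟨r, r'⟩
      rw [mem_reps]
      simp only [Finset.mem_insert, Finset.mem_singleton, Prod.mk.injEq]
      constructor
      · intro hr
        rcases D.sgnPt_add_eq hg hr.symm with h | h | ⟨-, rfl, h⟩
        · exact Or.inl h
        · exact Or.inl h
        · exact Or.inr ⟨h, h⟩
      · rintro (⟨rfl, rfl⟩ | ⟨rfl, rfl⟩)
        · rfl
        · rw [sgnPt_not]
          generalize D.sgnPt p = g
          obtain ⟨u, a, b⟩ := g
          refine Prod.ext ?_ (Prod.ext ?_ ?_)
          · change -u + -u = u + u
            revert u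
            decide
          · change -a + -a = a + a
            linear_combination -a * D.four_eq_zero
          · change -b + -b = b + b
            rw [CharTwo.neg_eq]
    rw [h2, Finset.card_pair]
    intro h
    have := congrArg (fun q => q.1.1) h
    simp at this
  · have h2 : D.reps (D.sgnPt p + D.sgnPt p') = {(p, p'), (p', p)} := by
      ext ⟨r, r'⟩
      rw [mem_reps]
      simp only [Finset.mem_insert, Finset.mem_singleton, Prod.mk.injEq]
      constructor
      · intro hr
        rcases D.sgnPt_add_eq hg hr.symm with h | h | ⟨h, -⟩
        · exact Or.inl h
        · exact Or.inr h
        · exact absurd h hpp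
      · rintro (⟨rfl, rfl⟩ | ⟨rfl, rfl⟩)
        · rfl
        · exact add_comm _ _
    rw [h2, Finset.card_pair]
    intro h
    exact hpp (congrArg Prod.fst h)

omit [Fintype R] in
lemma reps_eq_empty_of_onPlane {g : ZMod 4 × R × F} (hg : D.OnPlane g) (h0 : g ≠ 0) :
    D.reps g = ∅ := by
  rw [Finset.eq_empty_iff_forall_notMem]
  rintro ⟨p, p'⟩ hp
  rw [mem_reps] at hp
  subst hp
  simp only [OnPlane, Prod.fst_add, Prod.snd_add, map_add, sgnPt_fst, π_sgnPt] at hg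
  apply h0
  have h1 : p' = (!p.1, p.2) := by
    refine Prod.ext ?_ (CharTwo.add_eq_zero.mp hg.2).symm
    have h := hg.1
    simp only
    clear h0 hg
    generalize p.1 = b at *
    generalize p'.1 = b' at *
    revert b b'
    decide
  simp only [h1, sgnPt_not, add_neg_cancel]

omit [Fintype R] [CharP F 2] in
lemma reps_eq_empty_of_odd {g : ZMod 4 × R × F} (hg : g.1 = 1 ∨ g.1 = 3) : D.reps g = ∅ := by
  rw [Finset.eq_empty_iff_forall_notMem]
  rintro ⟨p, p'⟩ hp
  rw [mem_reps] at hp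
  subst hp
  simp only [Prod.fst_add, sgnPt_fst] at hg
  generalize p.1 = b at *
  generalize p'.1 = b' at *
  revert b b'
  decide

omit [CharP F 2] in
lemma shortBlock_eq_zero_iff {g : ZMod 4 × R × F} (hg : D.OnPlane g) :
    D.shortBlock g = 0 ↔ g = 0 := by
  obtain ⟨s, A, B⟩ := g
  obtain ⟨rfl, hA⟩ := hg
  obtain ⟨w, rfl⟩ := D.ker A hA
  rw [shortBlock, half_two_mul, TraceChar.planeBlock]
  simp only [Prod.mk_eq_zero, true_and, D.two_mul_eq_zero_iff]
  split_ifs with h1 h2 h3 <;> simp [*]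

lemma re_sq_mem : (fun z => (D.re z : ℂ) ^ 2) ∈ D.pairing.fibreConst D.block := by
  intro g g' h
  apply mul_left_cancel₀ (OfNat.ofNat_ne_zero 4 : (4 : ℂ) ≠ 0)
  rw [four_mul_ft_re_sq, four_mul_ft_re_sq]
  congr 2
  rcases D.block_eq_iff g g' h with ⟨h1, h2, h3⟩ | ⟨h1, h2, -, -, h3⟩ | ⟨h1, h2, -⟩
  · by_cases h0 : g = 0
    · have h0' := h3.symm.trans ((D.shortBlock_eq_zero_iff h1).mpr h0)
      rw [h0, (D.shortBlock_eq_zero_iff h2).mp h0']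
    · have h0' : g' ≠ 0 := fun h => h0 <| (D.shortBlock_eq_zero_iff h1).mp <|
        h3.trans ((D.shortBlock_eq_zero_iff h2).mpr h)
      rw [D.reps_eq_empty_of_onPlane h1 h0, D.reps_eq_empty_of_onPlane h2 h0']
  · by_cases h0 : D.reps g = ∅
    · rw [h0, h3.mp h0]
    · rw [D.card_reps_of_nonempty h1 h0, D.card_reps_of_nonempty h2 (mt h3.mpr h0)]
  · rw [D.reps_eq_empty_of_odd h1, D.reps_eq_empty_of_odd h2]

end GaloisData

end Blocks

section Scheme

namespace GaloisData

variable {R F : Type*} [CommRing R] [Fintype R] [Field F] [Fintype F] [CharP F 2]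
  (D : GaloisData R F) {n : ℕ} (hF : Fintype.card F = 2 * 4 ^ n) (hn : n ≠ 0)
  (hcube : ∀ x : F, ∃ y, y ^ 3 = x)

/-- The values, on the ten classes, of the indicators of `b = 0`, of `π a = b = 0`, of the rootless
cubics and of the even constants, and of the real part of the exponential sum. -/
def rows (s : ℂ) : Fin 10 → Fin 5 → ℂ :=
  ![![1, 1, 0, 1, 2 * s ^ 2], ![0, 0, 0, 0, 2 * s], ![1, 0, 0, 0, s], ![0, 0, 1, 0, s],
    ![1, 1, 0, 0, 0], ![0, 0, 0, 0, 0], ![0, 0, 1, 0, -s], ![1, 0, 0, 0, -s],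
    ![0, 0, 0, 0, -(2 * s)], ![1, 1, 0, 1, -(2 * s ^ 2)]]

/-- The linear combination with coefficients `c` of the spanning monomials in the entries of a
row. -/
def combination (c : Fin 10 → ℂ) (v : Fin 5 → ℂ) : ℂ :=
  c 0 + c 1 * v 0 + c 2 * v 1 + c 3 * v 2 + c 4 * v 3 + c 5 * v 4 + c 6 * (v 0 * v 4) +
    c 7 * (v 1 * v 4) + c 8 * (v 2 * v 4) + c 9 * v 4 ^ 2

set_option maxHeartbeats 2000000 in
lemma exists_combination_eq {s : ℂ} (hs : s ≠ 0) (i : Fin 10) :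
    ∃ c, ∀ j, combination c (rows s j) = if j = i then 1 else 0 := by
  refine ⟨![
      ![0, 0, 0, 0, 1 / 2, 0, 0, 1 / (4 * s ^ 2), 0, 0],
      ![0, -1 / 8, 1 / 8, -1 / 8, -s ^ 2 / 2, 1 / (4 * s), -1 / (4 * s), 0, -1 / (4 * s),
        1 / (8 * s ^ 2)],
      ![0, 1 / 2, -1 / 2, 0, 0, 0, 1 / (2 * s), -1 / (2 * s), 0, 0],
      ![0, 0, 0, 1 / 2, 0, 0, 0, 0, 1 / (2 * s), 0],
      ![0, 0, 1, 0, -1, 0, 0, 0, 0, 0],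
      ![1, -3 / 4, -1 / 4, -3 / 4, s ^ 2, 0, 0, 0, 0, -1 / (4 * s ^ 2)],
      ![0, 0, 0, 1 / 2, 0, 0, 0, 0, -1 / (2 * s), 0],
      ![0, 1 / 2, -1 / 2, 0, 0, 0, -1 / (2 * s), 1 / (2 * s), 0, 0],
      ![0, -1 / 8, 1 / 8, -1 / 8, -s ^ 2 / 2, -1 / (4 * s), 1 / (4 * s), 0, 1 / (4 * s),
        1 / (8 * s ^ 2)],
      ![0, 0, 0, 0, 1 / 2, 0, 0, -1 / (4 * s ^ 2), 0, 0]] i, fun j => ?_⟩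
  fin_cases i <;> fin_cases j <;> simp [combination, rows] <;> field_simp <;> ring

/-- The functions whose monomials span the indicators of the classes. -/
noncomputable def features (z : ZMod 4 × R × F) : Fin 5 → ℂ :=
  ![D.plane (fun _ b => if b = 0 then 1 else 0) z,
    D.plane (fun α b => if α = 0 ∧ b = 0 then 1 else 0) z,
    D.plane TraceChar.rootless z, evenConst z, D.re z]

include hF hn hcube in
lemma features_eq (z : ZMod 4 × R × F) : D.features z = rows (2 ^ n) (D.cls n z) := by
  have hroots : ∀ α : F, cubicRoots α 0 ≠ ∅ := fun α => by simp [TraceChar.cubicRoots_zero]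
  have h4 : (4 : ℂ) ^ n = (2 ^ n) ^ 2 := by
    rw [← pow_mul, mul_comm, pow_mul]
    norm_num
  have key : ∀ i, classSpec n (D.re z) (z.2.2 = 0) i → D.features z = rows (2 ^ n) i →
      D.features z = rows (2 ^ n) (D.cls n z) := fun i hi h => by
    rwa [(D.cls_eq_iff hF hn hcube z i).mpr hi]
  simp only [features, plane, TraceChar.rootless, evenConst] at key ⊢
  rcases D.re_cases hF hcube z with ⟨hb, ha, ⟨ha', hu, h | h⟩ | ⟨hu, h⟩⟩ | ⟨hb, ha, h | h⟩ |
    ⟨hb, ha, h | h⟩ | ⟨hb, ha, h | h | h⟩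
  · exact key 0 h (by simp [rows, h, hb, hroots, ha', hu, h4])
  · exact key 9 h (by simp [rows, h, hb, hroots, ha', hu, h4])
  · exact key 4 ⟨h, hb⟩ (by simp [rows, h, hb, ha, hroots]; tauto)
  · have : z.2.1 ≠ 0 := fun h => ha (by simp [h])
    exact key 2 ⟨h, hb⟩ (by simp [rows, h, hb, ha, hroots, this])
  · have : z.2.1 ≠ 0 := fun h => ha (by simp [h])
    exact key 7 ⟨h, hb⟩ (by simp [rows, h, hb, ha, hroots, this])
  · exact key 3 ⟨h, hb⟩ (by simp [rows, h, hb, ha])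
  · exact key 6 ⟨h, hb⟩ (by simp [rows, h, hb, ha])
  · exact key 5 ⟨h, hb⟩ (by simp [rows, h, hb, ha])
  · exact key 1 h (by simp [rows, h, hb, ha])
  · exact key 8 h (by simp [rows, h, hb, ha])

omit [CharP F 2] in
lemma planeBlock_congr {x y x' y' : F}
    (h : TraceChar.planeBlock x y = TraceChar.planeBlock x' y') :
    (x = 0 ↔ x' = 0) ∧ (x = 0 ∧ y = 0 ↔ x' = 0 ∧ y' = 0) := by
  unfold TraceChar.planeBlock at h
  split_ifs at h <;> simp_all

include hcube in
lemma combination_mem (c : Fin 10 → ℂ) :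
    (fun z => combination c (D.features z)) ∈ D.pairing.fibreConst D.block := by
  have hone : ∀ x y x' y' : F, TraceChar.planeBlock x y = TraceChar.planeBlock x' y' →
      D.t.hat (fun _ _ => 1) x y = D.t.hat (fun _ _ => 1) x' y' := fun x y x' y' h => by
    simp only [TraceChar.hat_one, (planeBlock_congr h).2]
  have hline : ∀ x y x' y' : F, TraceChar.planeBlock x y = TraceChar.planeBlock x' y' →
      D.t.hat (fun _ b => if b = 0 then 1 else 0) x y =
      D.t.hat (fun _ b => if b = 0 then 1 else 0) x' y' := fun x y x' y' h => by
    simp only [TraceChar.hat_line, (planeBlock_congr h).1]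
  have horigin : ∀ x y x' y' : F, TraceChar.planeBlock x y = TraceChar.planeBlock x' y' →
      D.t.hat (fun α b => if α = 0 ∧ b = 0 then 1 else 0) x y =
      D.t.hat (fun α b => if α = 0 ∧ b = 0 then 1 else 0) x' y' := fun x y x' y' h => by
    simp only [TraceChar.hat_origin]
  have hrootless : ∀ x y x' y' : F, TraceChar.planeBlock x y = TraceChar.planeBlock x' y' →
      D.t.hat TraceChar.rootless x y = D.t.hat TraceChar.rootless x' y' := fun x y x' y' h =>
    D.t.hat_rootless_congr hcube h
  have m0 := D.plane_mem hone
  have m5 := D.plane_mul_re_mem hone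
  simp only [plane, one_mul] at m0 m5
  have key : ∀ {φ : ZMod 4 × R × F → ℂ} (a : ℂ), φ ∈ D.pairing.fibreConst D.block →
      (fun z => a * φ z) ∈ D.pairing.fibreConst D.block := fun a h => Submodule.smul_mem _ a h
  have hadd : ∀ {φ φ' : ZMod 4 × R × F → ℂ}, φ ∈ D.pairing.fibreConst D.block →
      φ' ∈ D.pairing.fibreConst D.block →
      (fun z => φ z + φ' z) ∈ D.pairing.fibreConst D.block := fun h h' => Submodule.add_mem _ h h'
  have h0 := key (c 0) m0
  simp only [plane, mul_one] at h0
  have h := hadd (hadd (hadd (hadd (hadd (hadd (hadd (hadd (hadd h0 (key (c 1) (D.plane_mem hline)))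
    (key (c 2) (D.plane_mem horigin))) (key (c 3) (D.plane_mem hrootless)))
    (key (c 4) D.evenConst_mem)) (key (c 5) m5)) (key (c 6) (D.plane_mul_re_mem hline)))
    (key (c 7) (D.plane_mul_re_mem horigin))) (key (c 8) (D.plane_mul_re_mem hrootless)))
    (key (c 9) D.re_sq_mem)
  convert h using 2 with z
  simp [combination, features, plane]

include hF hn hcube in
lemma indicator_mem (i : Fin 10) :
    (fun z => if D.cls n z = i then (1 : ℂ) else 0) ∈ D.pairing.fibreConst D.block := by
  obtain ⟨c, hc⟩ := exists_combination_eq (s := 2 ^ n) (pow_ne_zero n two_ne_zero) i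
  convert D.combination_mem hcube c using 2 with z
  rw [D.features_eq hF hn hcube, hc]

include hF hn hcube in
/-- The translation scheme of the classes: the intersection numbers are well defined. -/
theorem conv_cls (i j : Fin 10) {z z' : ZMod 4 × R × F} (hz : D.cls n z = D.cls n z') :
    SelfPairing.conv (fun r => if D.cls n r = i then (1 : ℂ) else 0)
      (fun r => if D.cls n r = j then (1 : ℂ) else 0) z =
    SelfPairing.conv (fun r => if D.cls n r = i then (1 : ℂ) else 0)
      (fun r => if D.cls n r = j then (1 : ℂ) else 0) z' :=
  D.pairing.conv_indicator_const (by simp) (D.cls n) D.block (D.cls_surjective hF hn hcube)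
    (D.indicator_mem hF hn hcube) i j hz

end GaloisData

end Scheme

section Construction

namespace GaloisData

lemma trace_two_mul {R : Type*} [CommRing R] [Algebra (ZMod 4) R] (z : R) :
    Algebra.trace (ZMod 4) R (2 * z) = 2 * Algebra.trace (ZMod 4) R z := by
  rw [two_mul, map_add, two_mul]

lemma two_mul_trace_sq {R : Type*} [CommRing R] [Algebra (ZMod 4) R] [Module.Free (ZMod 4) R]
    [Module.Finite (ZMod 4) R] (z : R) :
    2 * Algebra.trace (ZMod 4) R (z ^ 2) = 2 * Algebra.trace (ZMod 4) R z := by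
  let red : ZMod 4 →+* ZMod 2 := ZMod.castHom (by norm_num) (ZMod 2)
  have hred : ∀ a b : ZMod 4, red a = red b → 2 * a = 2 * b := by decide
  have hpow : ∀ a : ZMod 2, a ^ 2 = a := by decide
  apply hred
  rw [Algebra.trace_eq_matrix_trace (Module.Free.chooseBasis (ZMod 4) R),
    Algebra.trace_eq_matrix_trace (Module.Free.chooseBasis (ZMod 4) R), map_pow,
    AddMonoidHom.map_trace, AddMonoidHom.map_trace, Matrix.map_pow, ZMod.trace_pow_card, hpow]

variable {R F : Type*} [CommRing R] [Algebra (ZMod 4) R] [Field F] (π : R →+* F)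
  (hker : ∀ z, π z = 0 → ∃ w, z = 2 * w)

section

omit [Field F] in
lemma algebra_four_eq_zero : (4 : R) = 0 := by
  have h : algebraMap (ZMod 4) R 4 = 0 := by
    rw [show (4 : ZMod 4) = 0 from rfl, map_zero]
  rwa [map_ofNat] at h

include hker

lemma two_mul_congr {w v : R} (h : π w = π v) : 2 * w = 2 * v := by
  obtain ⟨x, hx⟩ := hker (w - v) (by rw [map_sub, h, sub_self])
  linear_combination 2 * hx + x * algebra_four_eq_zero (R := R)

lemma sq_congr {w v : R} (h : π w = π v) : w ^ 2 = v ^ 2 := by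
  obtain ⟨x, hx⟩ := hker (w - v) (by rw [map_sub, h, sub_self])
  linear_combination (w + v) * hx + x * (two_mul_congr π hker h) + x * v *
    algebra_four_eq_zero (R := R)

lemma two_pow_congr {m : ℕ} (hm : m ≠ 0) {w v : R} (h : π w = π v) : w ^ 2 ^ m = v ^ 2 ^ m := by
  obtain ⟨k, rfl⟩ := Nat.exists_eq_succ_of_ne_zero hm
  rw [pow_succ', pow_mul, pow_mul, sq_congr π hker h]

end

variable [Fintype F] {m : ℕ} (hm : m ≠ 0) (hF : Fintype.card F = 2 ^ m)
  (hπ : Function.Surjective π)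

/-- The `2 ^ m`-th power of a lift. -/
noncomputable def lift (m : ℕ) (x : F) : R := Function.surjInv hπ x ^ 2 ^ m

omit [Algebra (ZMod 4) R] in
include hF in
lemma map_lift (x : F) : π (lift π hπ m x) = x := by
  rw [lift, map_pow, Function.surjInv_eq hπ, ← hF, FiniteField.pow_card]

include hm hker in
omit [Fintype F] in
lemma lift_map_eq (z : R) : lift π hπ m (π z) = z ^ 2 ^ m :=
  two_pow_congr π hker hm (Function.surjInv_eq hπ _)

include hm hF hker in
lemma lift_pow (x : F) : lift π hπ m x ^ 2 ^ m = lift π hπ m x := by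
  rw [← lift_map_eq π hker hm hπ, map_lift π hF hπ]

include hm hF hker in
lemma sq_eq_lift (z : R) : z ^ 2 = lift π hπ m (π z ^ 2) := by
  rw [← map_pow, lift_map_eq π hker hm hπ, ← pow_mul, mul_comm, pow_mul]
  refine sq_congr π hker ?_
  rw [map_pow, ← hF, FiniteField.pow_card]

variable [CharP F 2] [Module.Free (ZMod 4) R] [Module.Finite (ZMod 4) R]
  (hrank : Odd (Module.finrank (ZMod 4) R))

/-- The character of `F` induced by twice the trace of `R`. -/
noncomputable def traceChar : TraceChar F where
  χ :=
    { toFun := fun x => iPow (Algebra.trace (ZMod 4) R (2 * Function.surjInv hπ x))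
      map_zero_eq_one' := by
        rw [two_mul_congr π hker (v := 0) (by rw [Function.surjInv_eq hπ, map_zero])]
        simp
      map_add_eq_mul' := fun x y => by
        rw [two_mul_congr π hker (v := Function.surjInv hπ x + Function.surjInv hπ y)
          (by simp only [map_add, Function.surjInv_eq hπ]),
          mul_add, map_add, AddChar.map_add_eq_mul] }
  map_sq := fun x => by
    change iPow (Algebra.trace (ZMod 4) R (2 * Function.surjInv hπ (x ^ 2))) =
      iPow (Algebra.trace (ZMod 4) R (2 * Function.surjInv hπ x))
    rw [two_mul_congr π hker (v := Function.surjInv hπ x ^ 2)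
      (by simp only [map_pow, Function.surjInv_eq hπ]), trace_two_mul, trace_two_mul,
      two_mul_trace_sq]
  map_one := by
    change iPow (Algebra.trace (ZMod 4) R (2 * Function.surjInv hπ 1)) = -1
    have : Nontrivial (ZMod 4) := ⟨0, 1, by decide⟩
    obtain ⟨k, hk⟩ := hrank
    have h2 : ∀ x : ZMod 4, 2 * (2 * x + 1) = 1 + 1 := by decide
    rw [two_mul_congr π hker (v := 1) (by rw [Function.surjInv_eq hπ, map_one]), trace_two_mul,
      ← map_one (algebraMap (ZMod 4) R), Algebra.trace_algebraMap, hk, nsmul_one, Nat.cast_add,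
      Nat.cast_mul, Nat.cast_two, Nat.cast_one, h2, AddChar.map_add_eq_mul, iPow_one,
      Complex.I_mul_I]

/-- The data attached to a finite free algebra over `ℤ/4ℤ` of odd rank whose reduction is a
field. -/
noncomputable def ofResidueMap : GaloisData R F where
  π := π
  T := (Algebra.trace (ZMod 4) R).toAddMonoidHom
  t := traceChar π hker hπ hrank
  τ := lift π hπ m
  four_eq_zero := algebra_four_eq_zero
  ker := hker
  π_τ := map_lift π hF hπ
  sq_eq := sq_eq_lift π hker hm hF hπ
  χ_π := fun z => by
    change iPow (Algebra.trace (ZMod 4) R (2 * z)) =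
      iPow (Algebra.trace (ZMod 4) R (2 * Function.surjInv hπ (π z)))
    rw [two_mul_congr π hker (Function.surjInv_eq hπ (π z))]

end GaloisData

end Construction

section Reduction

variable (f : (ZMod 4)[X])

/-- The reduction of `ℤ/4ℤ` modulo `2`. -/
abbrev reduction : ZMod 4 →+* ZMod 2 := ZMod.castHom (show (2 : ℕ) ∣ 4 by norm_num) (ZMod 2)

/-- The residue map of the Galois ring. -/
noncomputable def residueMap : AdjoinRoot f →+* AdjoinRoot (f.map reduction) :=
  AdjoinRoot.map reduction f _ dvd_rfl

lemma residueMap_mk (p : (ZMod 4)[X]) :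
    residueMap f (AdjoinRoot.mk f p) = AdjoinRoot.mk (f.map reduction) (p.map reduction) := by
  rw [residueMap, AdjoinRoot.map, AdjoinRoot.lift_mk, ← Polynomial.eval₂_map]
  exact AdjoinRoot.aeval_eq _

lemma map_reduction_surjective : Function.Surjective (Polynomial.map reduction) :=
  Polynomial.map_surjective _ (ZMod.castHom_surjective _)

lemma residueMap_surjective : Function.Surjective (residueMap f) := by
  intro x
  obtain ⟨p, rfl⟩ := AdjoinRoot.mk_surjective x
  obtain ⟨p, rfl⟩ := map_reduction_surjective p
  exact ⟨AdjoinRoot.mk f p, residueMap_mk f p⟩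

lemma exists_eq_two_mul_of_map_reduction {p : (ZMod 4)[X]} (h : p.map reduction = 0) :
    ∃ w, p = 2 * w := by
  have key : ∀ x : ZMod 4, reduction x = 0 → 2 ∣ x := by decide
  obtain ⟨w, hw⟩ := (Polynomial.C_dvd_iff_dvd_coeff 2 p).mpr fun i => key _ <| by
    rw [← Polynomial.coeff_map, h, Polynomial.coeff_zero]
  exact ⟨w, by rw [hw, map_ofNat]⟩

lemma residueMap_eq_zero (z : AdjoinRoot f) (h : residueMap f z = 0) : ∃ w, z = 2 * w := by
  obtain ⟨p, rfl⟩ := AdjoinRoot.mk_surjective z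
  rw [residueMap_mk, AdjoinRoot.mk_eq_zero] at h
  obtain ⟨g, hg⟩ := h
  obtain ⟨g, rfl⟩ := map_reduction_surjective g
  obtain ⟨w, hw⟩ := exists_eq_two_mul_of_map_reduction (p := p - f * g) (by
    rw [Polynomial.map_sub, Polynomial.map_mul, hg, sub_self])
  refine ⟨AdjoinRoot.mk f w, ?_⟩
  have := congrArg (AdjoinRoot.mk f) hw
  simpa only [map_sub, map_mul, AdjoinRoot.mk_self, zero_mul, sub_zero, map_ofNat] using this

variable {f} (hmonic : f.Monic)
include hmonic

lemma finrank_adjoinRoot : Module.finrank (ZMod 4) (AdjoinRoot f) = f.natDegree := by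
  have : Nontrivial (ZMod 4) := ⟨0, 1, by decide⟩
  rw [(AdjoinRoot.powerBasis' hmonic).finrank, AdjoinRoot.powerBasis'_dim]

lemma finite_adjoinRoot : Finite (AdjoinRoot f) :=
  have := hmonic.finite_adjoinRoot
  Module.finite_of_finite (ZMod 4)

lemma finite_adjoinRoot_map : Finite (AdjoinRoot (f.map reduction)) :=
  have := finite_adjoinRoot hmonic
  Finite.of_surjective _ (residueMap_surjective f)

lemma natCard_adjoinRoot_map :
    Nat.card (AdjoinRoot (f.map reduction)) = 2 ^ f.natDegree := by
  have := (hmonic.map reduction).finite_adjoinRoot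
  have := (hmonic.map reduction).free_adjoinRoot
  rw [Module.natCard_eq_pow_finrank (K := ZMod 2), Nat.card_zmod,
    (AdjoinRoot.powerBasis' (hmonic.map reduction)).finrank, AdjoinRoot.powerBasis'_dim,
    hmonic.natDegree_map]

end Reduction

section Code

namespace GaloisData

open SelfPairing

variable {m n : ℕ} {f : (ZMod 4)[X]} {F : Type*} [Fintype (AdjoinRoot f)] [Field F] [Fintype F]
  [CharP F 2] (D : GaloisData (AdjoinRoot f) F)

omit [Fintype (AdjoinRoot f)] [Field F] [CharP F 2] in
/-- The Lee weight of a word, indexed by the residue field. -/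
lemma leeWt_eq (e : F ≃ Teich m f) (v : Word m f) : leeWt m f v = ∑ x, symWt (v (e x)) := by
  rw [leeWt, ← finsum_comp_equiv e, finsum_eq_sum_of_fintype]

variable (hT : ∀ a, D.T a = Algebra.trace (ZMod 4) (AdjoinRoot f) a)
  (hτ : ∀ z : AdjoinRoot f, z ^ 2 ^ m = z ↔ ∃ x, D.τ x = z)

/-- The codeword with given parameters. -/
noncomputable def codeword (m : ℕ) (z : ZMod 4 × AdjoinRoot f × F) : Word m f :=
  cword m f z.1 z.2.1 (D.τ z.2.2)

/-- The Teichmüller set is parametrized by the residue field. -/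
noncomputable def teichEquiv : F ≃ Teich m f :=
  Equiv.ofBijective (fun x => ⟨D.τ x, (hτ _).mpr ⟨x, rfl⟩⟩)
    ⟨fun x y h => by
      have h' : D.τ x = D.τ y := congrArg Subtype.val h
      rw [← D.π_τ x, ← D.π_τ y, h'], fun ⟨z, hz⟩ => by
      obtain ⟨x, rfl⟩ := (hτ z).mp hz
      exact ⟨x, rfl⟩⟩

omit [Fintype (AdjoinRoot f)] [Fintype F] [CharP F 2] in
include hT in
lemma codeword_teichEquiv (z : ZMod 4 × AdjoinRoot f × F) (x : F) :
    D.codeword m z (D.teichEquiv hτ x) = D.phase z x := by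
  rw [phase, hT]
  rfl

omit [Fintype (AdjoinRoot f)] [CharP F 2] in
include hT hτ in
lemma leeWt_codeword (z : ZMod 4 × AdjoinRoot f × F) :
    (leeWt m f (D.codeword m z) : ℤ) = Fintype.card F - D.re z := by
  simp only [leeWt_eq (D.teichEquiv hτ), D.codeword_teichEquiv hT hτ, re, rePow,
    Finset.sum_sub_distrib, Finset.sum_const, Finset.card_univ]
  simp

omit [Fintype (AdjoinRoot f)] [Fintype F] [CharP F 2] in
include hT hτ in
lemma codeword_ext_iff (v : Word m f) (z : ZMod 4 × AdjoinRoot f × F) :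
    D.codeword m z = v ↔ ∀ x, D.phase z x = v (D.teichEquiv hτ x) := by
  rw [funext_iff, (D.teichEquiv hτ).forall_congr_right.symm]
  simp only [D.codeword_teichEquiv hT hτ]

omit [Fintype (AdjoinRoot f)] [Fintype F] [CharP F 2] in
lemma phase_add (z z' : ZMod 4 × AdjoinRoot f × F) (x : F) :
    D.phase (z + z') x = D.phase z x + D.phase z' x := by
  have h : 2 * D.τ (z.2.2 + z'.2.2) = 2 * (D.τ z.2.2 + D.τ z'.2.2) := by
    simp only [D.two_mul_eq_iff, map_add, D.π_τ]
  simp only [phase, Prod.fst_add, Prod.snd_add, h, mul_add, add_mul, map_add]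
  abel

omit [Fintype (AdjoinRoot f)] [Fintype F] [CharP F 2] in
include hT hτ in
lemma codeword_add (z z' : ZMod 4 × AdjoinRoot f × F) :
    D.codeword m (z + z') = D.codeword m z + D.codeword m z' := by
  rw [D.codeword_ext_iff hT hτ]
  intro x
  rw [Pi.add_apply, D.codeword_teichEquiv hT hτ, D.codeword_teichEquiv hT hτ, phase_add]

omit [Fintype (AdjoinRoot f)] [Fintype F] [CharP F 2] in
include hT hτ in
lemma codeword_neg (z : ZMod 4 × AdjoinRoot f × F) :
    D.codeword m (-z) = -D.codeword m z := by
  rw [D.codeword_ext_iff hT hτ]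
  intro x
  rw [Pi.neg_apply, D.codeword_teichEquiv hT hτ, phase_neg]

variable (hF : Fintype.card F = 2 * 4 ^ n) (hn : n ≠ 0) (hcube : ∀ x : F, ∃ y, y ^ 3 = x)

include hF hn hcube in
lemma eq_zero_of_phase_eq_zero {z : ZMod 4 × AdjoinRoot f × F} (h : ∀ x, D.phase z x = 0) :
    z = 0 := by
  have hre : D.re z = 2 * 4 ^ n := by
    have : rePow 0 = 1 := by decide
    simp only [re, h, this, Finset.sum_const, Finset.card_univ, hF]
    simp
  obtain ⟨h1, h2⟩ := two_pow_bounds hn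
  have hu : z.1 = 0 := by simpa [phase, τ_zero] using h 0
  rcases D.re_cases hF hcube z with ⟨hb, -, ⟨ha, -⟩ | ⟨-, h⟩⟩ | ⟨-, -, h | h⟩ |
    ⟨-, -, h | h⟩ | ⟨-, -, h | h | h⟩
  · exact Prod.ext hu (Prod.ext ha hb)
  all_goals omega

include hT hτ hF hn hcube in
lemma codeword_injective : Function.Injective (D.codeword m) := by
  intro z z' h
  rw [← sub_eq_zero]
  refine D.eq_zero_of_phase_eq_zero hF hn hcube fun x => ?_
  rw [← D.codeword_teichEquiv hT hτ, sub_eq_add_neg, D.codeword_add hT hτ, D.codeword_neg hT hτ, h,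
    add_neg_cancel, Pi.zero_apply]

omit [Fintype (AdjoinRoot f)] [Fintype F] [CharP F 2] in
include hτ in
lemma mem_DG_iff (v : Word m f) : v ∈ DG m f ↔ ∃ z, D.codeword m z = v := by
  constructor
  · rintro ⟨u, a, b, hb, rfl⟩
    obtain ⟨b, rfl⟩ := (hτ b).mp hb
    exact ⟨(u, a, b), rfl⟩
  · rintro ⟨z, rfl⟩
    exact ⟨z.1, z.2.1, _, (hτ _).mpr ⟨_, rfl⟩, rfl⟩

include hT hτ hF hn hcube in
lemma codeword_mem_Kerdock_iff (z : ZMod 4 × AdjoinRoot f × F) :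
    D.codeword m z ∈ Kerdock m f ↔ z.2.2 = 0 := by
  constructor
  · rintro ⟨u, a, h⟩
    have h' : D.codeword m z = D.codeword m (u, a, 0) := by rw [h, codeword, τ_zero]
    rw [D.codeword_injective hT hτ hF hn hcube h']
  · intro h
    exact ⟨z.1, z.2.1, by rw [codeword, h, τ_zero]⟩

variable (hmn : m = 2 * n + 1)

include hT hτ hF hn hcube hmn in
lemma codeword_mem_DGclass'_iff (z : ZMod 4 × AdjoinRoot f × F) (i : Fin 10) :
    D.codeword m z ∈ DGclass' m f i ↔ D.cls n z = i := by
  have hDG : D.codeword m z ∈ DG m f := (D.mem_DG_iff hτ _).mpr ⟨z, rfl⟩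
  have hw := D.leeWt_codeword hT hτ z
  rw [hF] at hw
  have hm1 : 2 ^ m = 2 * 4 ^ n := by rw [hmn, pow_succ', pow_mul]; norm_num
  have hm2 : 2 ^ ((m + 1) / 2) = 2 * 2 ^ n := by
    rw [← pow_succ']
    congr 1
    omega
  have hm3 : (m - 1) / 2 = n := by omega
  have hK := D.codeword_mem_Kerdock_iff hT hτ hF hn hcube z
  obtain ⟨h1, h2⟩ := two_pow_bounds hn
  rw [D.cls_eq_iff hF hn hcube]
  push_cast at hw
  have h3 : (2 ^ n : ℤ) = (2 ^ n : ℕ) := by push_cast; rfl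
  have h4 : (4 ^ n : ℤ) = (4 ^ n : ℕ) := by push_cast; rfl
  rw [h3] at h1 h2
  rw [h4] at h2 hw
  fin_cases i
  all_goals
    dsimp [DGclass', classSpec]
    simp only [hm1, hm2, hm3, h3, h4, hDG, hK, true_and]
    generalize 2 ^ n = s at *
    generalize 4 ^ n = q at *
    by_cases hk : z.2.2 = 0
    all_goals
      try simp only [hk, and_true, and_false, not_true, not_false_iff]
      try omega

end GaloisData

end Code

section Scheme

namespace GaloisData

variable {m n : ℕ} {f : (ZMod 4)[X]} {F : Type*} [Fintype (AdjoinRoot f)] [Field F] [Fintype F]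
  [CharP F 2] (D : GaloisData (AdjoinRoot f) F)
  (hT : ∀ a, D.T a = Algebra.trace (ZMod 4) (AdjoinRoot f) a)
  (hτ : ∀ z : AdjoinRoot f, z ^ 2 ^ m = z ↔ ∃ x, D.τ x = z)
  (hF : Fintype.card F = 2 * 4 ^ n) (hn : n ≠ 0) (hcube : ∀ x : F, ∃ y, y ^ 3 = x)
  (hmn : m = 2 * n + 1)

omit [Fintype (AdjoinRoot f)] in
lemma DGclass'_subset (i : Fin 10) {v : Word m f} (hv : v ∈ DGclass' m f i) : v ∈ DG m f := by
  fin_cases i <;> exact hv.1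

include hF hn hcube in
lemma cls_neg (z : ZMod 4 × AdjoinRoot f × F) : D.cls n (-z) = D.cls n z := by
  rw [D.cls_eq_iff hF hn hcube, re_neg, Prod.snd_neg, Prod.snd_neg, neg_eq_zero,
    ← D.cls_eq_iff hF hn hcube]

include hT hτ hF hn hcube hmn

lemma existsUnique_mem_DGclass' {v : Word m f} (hv : v ∈ DG m f) :
    ∃! i, v ∈ DGclass' m f i := by
  obtain ⟨z, rfl⟩ := (D.mem_DG_iff hτ v).mp hv
  simp only [D.codeword_mem_DGclass'_iff hT hτ hF hn hcube hmn]
  exact ⟨_, rfl, fun _ h => h.symm⟩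

lemma neg_mem_DGclass' (i : Fin 10) {v : Word m f} (hv : v ∈ DGclass' m f i) :
    -v ∈ DGclass' m f i := by
  obtain ⟨z, rfl⟩ := (D.mem_DG_iff hτ v).mp (DGclass'_subset i hv)
  rw [D.codeword_mem_DGclass'_iff hT hτ hF hn hcube hmn] at hv
  rw [← D.codeword_neg hT hτ, D.codeword_mem_DGclass'_iff hT hτ hF hn hcube hmn,
    D.cls_neg hF hn hcube, hv]

lemma natCard_pairs (i j : Fin 10) (z : ZMod 4 × AdjoinRoot f × F) :
    Nat.card {p : Word m f × Word m f //
      p.1 ∈ DGclass' m f i ∧ p.2 ∈ DGclass' m f j ∧ p.1 + p.2 = D.codeword m z} =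
    Nat.card {r // D.cls n r = i ∧ D.cls n (z - r) = j} := by
  have hmem := D.codeword_mem_DGclass'_iff hT hτ hF hn hcube hmn
  have hinj := D.codeword_injective hT hτ hF hn hcube
  symm
  refine Nat.card_eq_of_bijective
    (fun r => ⟨(D.codeword m r.1, D.codeword m (z - r.1)), (hmem _ _).mpr r.2.1,
      (hmem _ _).mpr r.2.2, by rw [← D.codeword_add hT hτ, add_sub_cancel]⟩) ⟨?_, ?_⟩
  · intro r s h
    exact Subtype.ext (hinj (congrArg (fun p => p.1.1) h))
  · rintro ⟨⟨v, w⟩, hv, hw, h⟩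
    obtain ⟨r, rfl⟩ := (D.mem_DG_iff hτ v).mp (DGclass'_subset i hv)
    obtain ⟨s, rfl⟩ := (D.mem_DG_iff hτ w).mp (DGclass'_subset j hw)
    rw [← D.codeword_add hT hτ] at h
    obtain rfl := hinj h
    refine ⟨⟨r, (hmem _ _).mp hv, ?_⟩, ?_⟩
    · rw [add_sub_cancel_left]
      exact (hmem _ _).mp hw
    · simp only [add_sub_cancel_left]

lemma natCard_pairs_eq_conv (i j : Fin 10) (z : ZMod 4 × AdjoinRoot f × F) :
    (Nat.card {p : Word m f × Word m f //
      p.1 ∈ DGclass' m f i ∧ p.2 ∈ DGclass' m f j ∧ p.1 + p.2 = D.codeword m z} : ℂ) =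
    SelfPairing.conv (fun r => if D.cls n r = i then (1 : ℂ) else 0)
      (fun r => if D.cls n r = j then (1 : ℂ) else 0) z := by
  rw [D.natCard_pairs hT hτ hF hn hcube hmn, Nat.card_eq_fintype_card, Fintype.card_subtype]
  simp only [SelfPairing.conv, ← ite_and, mul_ite, mul_one, mul_zero, Finset.sum_boole, and_comm]

lemma natCard_pairs_congr (i j k : Fin 10) {v w : Word m f} (hv : v ∈ DGclass' m f k)
    (hw : w ∈ DGclass' m f k) :
    Nat.card {p : Word m f × Word m f //
      p.1 ∈ DGclass' m f i ∧ p.2 ∈ DGclass' m f j ∧ p.1 + p.2 = v} =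
    Nat.card {p : Word m f × Word m f //
      p.1 ∈ DGclass' m f i ∧ p.2 ∈ DGclass' m f j ∧ p.1 + p.2 = w} := by
  obtain ⟨y, rfl⟩ := (D.mem_DG_iff hτ v).mp (DGclass'_subset k hv)
  obtain ⟨z, rfl⟩ := (D.mem_DG_iff hτ w).mp (DGclass'_subset k hw)
  rw [D.codeword_mem_DGclass'_iff hT hτ hF hn hcube hmn] at hv hw
  apply Nat.cast_injective (R := ℂ)
  rw [D.natCard_pairs_eq_conv hT hτ hF hn hcube hmn, D.natCard_pairs_eq_conv hT hτ hF hn hcube hmn,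
    D.conv_cls hF hn hcube i j (hv.trans hw.symm)]

end GaloisData

end Scheme

end DelsarteGoethals

open DelsarteGoethals GaloisData in
/-- For odd `m ≥ 3` the ten refined classes partition the
Delsarte–Goethals code, each is closed under negation, and the induced translation
relations form a 9-class association scheme: for any two classes `C, C'` and any two
codewords `z, z'` in the same class, the number of pairs `(r,s) ∈ C × C'` with
`r + s = z` equals the number of pairs with `r + s = z'`. -/
theorem statement2 (m : ℕ) (hm : Odd m) (hm3 : 3 ≤ m)
    (f : Polynomial (ZMod 4)) (hmonic : f.Monic) (hdeg : f.natDegree = m)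
    (hirr : Irreducible (f.map (ZMod.castHom (show (2:ℕ) ∣ 4 by norm_num) (ZMod 2)))) :
    (∀ z ∈ DG m f, ∃! i : Fin 10, z ∈ DGclass' m f i) ∧
    (∀ i : Fin 10, ∀ z : Word m f, z ∈ DGclass' m f i ↔ -z ∈ DGclass' m f i) ∧
    (∀ i j k : Fin 10, ∀ z z' : Word m f, z ∈ DGclass' m f k → z' ∈ DGclass' m f k →
      Nat.card {p : Word m f × Word m f //
          p.1 ∈ DGclass' m f i ∧ p.2 ∈ DGclass' m f j ∧ p.1 + p.2 = z} =
      Nat.card {p : Word m f × Word m f //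
          p.1 ∈ DGclass' m f i ∧ p.2 ∈ DGclass' m f j ∧ p.1 + p.2 = z'}) := by
  have : Fact (Irreducible (f.map reduction)) := ⟨hirr⟩
  have := hmonic.free_adjoinRoot
  have := hmonic.finite_adjoinRoot
  have := finite_adjoinRoot hmonic
  have := finite_adjoinRoot_map hmonic
  have := Fintype.ofFinite (AdjoinRoot f)
  have := Fintype.ofFinite (AdjoinRoot (f.map reduction))
  have : CharP (AdjoinRoot (f.map reduction)) 2 :=
    charP_of_injective_algebraMap (algebraMap (ZMod 2) _).injective 2
  have hcard : Fintype.card (AdjoinRoot (f.map reduction)) = 2 ^ m := by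
    rw [← Nat.card_eq_fintype_card, natCard_adjoinRoot_map hmonic, hdeg]
  have hker := residueMap_eq_zero f
  have hπ := residueMap_surjective f
  have hm0 : m ≠ 0 := by omega
  let D : GaloisData (AdjoinRoot f) (AdjoinRoot (f.map reduction)) :=
    ofResidueMap (residueMap f) hker hm0 hcard hπ (by rwa [finrank_adjoinRoot hmonic, hdeg])
  have hT : ∀ a, D.T a = Algebra.trace (ZMod 4) (AdjoinRoot f) a := fun _ => rfl
  have hτ : ∀ z : AdjoinRoot f, z ^ 2 ^ m = z ↔ ∃ x, D.τ x = z := fun z =>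
    ⟨fun h => ⟨residueMap f z, (lift_map_eq _ hker hm0 hπ z).trans h⟩, by
      rintro ⟨x, rfl⟩
      exact lift_pow _ hker hm0 hcard hπ x⟩
  have hcube := exists_cube_eq hm hcard
  obtain ⟨n, hmn⟩ := hm
  have hn : n ≠ 0 := by omega
  have hF : Fintype.card (AdjoinRoot (f.map reduction)) = 2 * 4 ^ n := by
    rw [hcard, hmn, pow_succ', pow_mul]
    norm_num
  have hneg := D.neg_mem_DGclass' hT hτ hF hn hcube hmn
  refine ⟨fun z => D.existsUnique_mem_DGclass' hT hτ hF hn hcube hmn,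
    fun i z => ⟨hneg i, fun h => ?_⟩,
    fun i j k z z' => D.natCard_pairs_congr hT hτ hF hn hcube hmn i j k⟩
  simpa only [neg_neg] using hneg i h
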